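/- arXiv:2008.00246 — 9 statements merged into one kernel-verified Lean document; each statement's English description precedes it below -/
import Mathlib

section
/- Let f, g be nonzero polynomials in k[x₁,...,xₙ] with leading coefficients Lc(f) = Lc(g) = 1 and with coprime leading monomials, gcd(Lm(f), Lm(g)) = 1. Then: (1) the S-polynomial satisfies S(f,g) = Lm(g)·f − Lm(f)·g; and (2) S(f,g) = −(g − Lm(g))·f + (f − Lm(f))·g, and this is a standard representation, i.e., the leading monomials of the two summands (g − Lm(g))·f and (f − Lm(f))·g are each ≤ Lm(S(f,g)) in the monomial order; in particular S(f,g) reduces to zero modulo {f, g}. -/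
open MvPolynomial

/-- A monomial order on the exponent vectors `Fin nv →₀ ℕ`: a linear order which is
compatible with addition and for which `0` is the least element. -/
structure MonomialOrdering (nv : ℕ) where
  ord : LinearOrder (Fin nv →₀ ℕ)
  add_le_add : ∀ u v w : Fin nv →₀ ℕ, ord.le u v → ord.le (u + w) (v + w)
  zero_le : ∀ u : Fin nv →₀ ℕ, ord.le 0 u

/-- The leading exponent (multidegree) of a polynomial with respect to a monomial
ordering; by convention the multidegree of `0` is `0`. -/
noncomputable def mdeg {k : Type*} [Field k] {nv : ℕ} (m : MonomialOrdering nv)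
    (f : MvPolynomial (Fin nv) k) : Fin nv →₀ ℕ :=
  letI := m.ord
  haveI := Classical.dec (f = 0)
  if h : f = 0 then 0 else f.support.max' (by
    rw [Finset.nonempty_iff_ne_empty, Ne, MvPolynomial.support_eq_empty]; exact h)

/-- The leading coefficient `Lc(f)`. -/
noncomputable def lc {k : Type*} [Field k] {nv : ℕ} (m : MonomialOrdering nv)
    (f : MvPolynomial (Fin nv) k) : k :=
  MvPolynomial.coeff (mdeg m f) f

/-- The leading monomial `Lm(f)` (with coefficient `1`). -/
noncomputable def lm {k : Type*} [Field k] {nv : ℕ} (m : MonomialOrdering nv)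
    (f : MvPolynomial (Fin nv) k) : MvPolynomial (Fin nv) k :=
  MvPolynomial.monomial (mdeg m f) (1 : k)

/-- The S-polynomial `S(f,g) = (lcm(Lm f, Lm g)/Lt f)·f − (lcm(Lm f, Lm g)/Lt g)·g`. -/
noncomputable def sPoly {k : Type*} [Field k] {nv : ℕ} (m : MonomialOrdering nv)
    (f g : MvPolynomial (Fin nv) k) : MvPolynomial (Fin nv) k :=
  MvPolynomial.monomial ((mdeg m f ⊔ mdeg m g) - mdeg m f) (lc m f)⁻¹ * f -
    MvPolynomial.monomial ((mdeg m f ⊔ mdeg m g) - mdeg m g) (lc m g)⁻¹ * g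

namespace MonomialOrdering

variable {nv : ℕ} (m : MonomialOrdering nv)

theorem le_of_le {u v : Fin nv →₀ ℕ} (h : u ≤ v) : m.ord.le u v := by
  have := m.add_le_add 0 (v - u) u (m.zero_le _)
  rwa [zero_add, tsub_add_cancel_of_le h] at this

/-- A monomial ordering is a well-order, by Dickson's lemma. -/
theorem wellFounded_lt : WellFounded m.ord.lt := by
  have hwqo : WellQuasiOrdered m.ord.le := fun s => by
    obtain ⟨i, j, hij, h⟩ := wellQuasiOrdered_le s
    exact ⟨i, j, hij, m.le_of_le h⟩
  exact (@WellQuasiOrderedLE.to_wellFoundedLT _ m.ord.toPreorder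
    (@WellQuasiOrderedLE.mk _ m.ord.toLE hwqo)).wf

/-- The bundled Mathlib monomial order given by a monomial ordering. -/
noncomputable def toMonomialOrder : MonomialOrder (Fin nv) where
  syn := Fin nv →₀ ℕ
  addCommMonoidSyn := inferInstance
  linearOrderSyn := m.ord
  isOrderedAddMonoid_syn :=
    @IsOrderedAddMonoid.mk _ _ m.ord.toPreorder
      (fun u v h w => m.add_le_add u v w h) (fun u v h w => by
        simpa only [add_comm w] using m.add_le_add u v w h)
  toSyn := AddEquiv.refl _
  toSyn_monotone := fun _ _ h => m.le_of_le h
  wellFoundedLT_syn := ⟨m.wellFounded_lt⟩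

theorem toMonomialOrder_toSyn_le_iff {u v : Fin nv →₀ ℕ} :
    m.toMonomialOrder.toSyn u ≤ m.toMonomialOrder.toSyn v ↔ m.ord.le u v :=
  Iff.rfl

theorem mdeg_eq_degree {k : Type*} [Field k] (f : MvPolynomial (Fin nv) k) :
    mdeg m f = m.toMonomialOrder.degree f := by
  by_cases hf : f = 0
  · simp [mdeg, hf]
  · rw [mdeg, dif_neg hf]
    apply m.ord.le_antisymm
    · exact m.toMonomialOrder.le_degree (@Finset.max'_mem _ m.ord _ (support_nonempty.2 hf))
    · exact @Finset.le_max' _ m.ord _ _ (m.toMonomialOrder.degree_mem_support hf)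

end MonomialOrdering

namespace MonomialOrder

variable {σ : Type*} (m : MonomialOrder σ)

/-- If the leading monomials of `f` and `g` are coprime, no cancellation of leading terms occurs
between `(g - Lt g) * f` and `(f - Lt f) * g`. -/
theorem degree_sub_leadingTerm_mul_ne {R : Type*} [CommRing R] [NoZeroDivisors R]
    {f g : MvPolynomial σ R} (hcop : ∀ i, m.degree f i = 0 ∨ m.degree g i = 0)
    (hf : f - m.leadingTerm f ≠ 0) (hg : g - m.leadingTerm g ≠ 0) :
    m.degree ((g - m.leadingTerm g) * f) ≠ m.degree ((f - m.leadingTerm f) * g) := by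
  have hf0 : f ≠ 0 := by rintro rfl; simp at hf
  have hg0 : g ≠ 0 := by rintro rfl; simp at hg
  rw [m.degree_mul hg hf0, m.degree_mul hf hg0]
  intro h
  refine (m.degree_sub_leadingTerm_lt_degree
    (m.degree_ne_zero_of_sub_leadingTerm_ne_zero hf)).not_ge (m.toSyn_monotone fun i => ?_)
  have hi := DFunLike.congr_fun h i
  simp only [Finsupp.add_apply] at hi
  rcases hcop i with hi' | hi' <;> omega

end MonomialOrder

/-- Let `f, g` be nonzero polynomials with `Lc f = Lc g = 1` and
coprime leading monomials.  Then (1) `S(f,g) = Lm(g)·f − Lm(f)·g`; and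
(2) `S(f,g) = −(g − Lm g)·f + (f − Lm f)·g` is a standard representation: the leading
monomials of the two summands are `≤ Lm(S(f,g))`; in particular `S(f,g)` reduces to
zero modulo `{f, g}`. -/
theorem sPoly_coprime_leading_monomials {k : Type*} [Field k] {nv : ℕ}
    (m : MonomialOrdering nv) (f g : MvPolynomial (Fin nv) k)
    (hf : f ≠ 0) (hg : g ≠ 0) (hlcf : lc m f = 1) (hlcg : lc m g = 1)
    (hcop : ∀ i : Fin nv, mdeg m f i = 0 ∨ mdeg m g i = 0) :
    sPoly m f g = lm m g * f - lm m f * g ∧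
    sPoly m f g = -((g - lm m g) * f) + (f - lm m f) * g ∧
    ((g - lm m g) * f = 0 ∨ m.ord.le (mdeg m ((g - lm m g) * f)) (mdeg m (sPoly m f g))) ∧
    ((f - lm m f) * g = 0 ∨ m.ord.le (mdeg m ((f - lm m f) * g)) (mdeg m (sPoly m f g))) ∧
    (∃ a b : MvPolynomial (Fin nv) k, sPoly m f g = a * f + b * g ∧
      (a * f = 0 ∨ m.ord.le (mdeg m (a * f)) (mdeg m (sPoly m f g))) ∧
      (b * g = 0 ∨ m.ord.le (mdeg m (b * g)) (mdeg m (sPoly m f g)))) := by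
  have hltf : lm m f = m.toMonomialOrder.leadingTerm f := by
    rw [lm, ← hlcf, lc, m.mdeg_eq_degree]; rfl
  have hltg : lm m g = m.toMonomialOrder.leadingTerm g := by
    rw [lm, ← hlcg, lc, m.mdeg_eq_degree]; rfl
  have hsupf : mdeg m f ⊔ mdeg m g - mdeg m f = mdeg m g := by
    ext i; rcases hcop i with h | h <;> simp [h]
  have hsupg : mdeg m f ⊔ mdeg m g - mdeg m g = mdeg m f := by
    ext i; rcases hcop i with h | h <;> simp [h]
  have hS : sPoly m f g = lm m g * f - lm m f * g := by
    rw [sPoly, hsupf, hsupg, hlcf, hlcg, inv_one]; rfl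
  have hS' : sPoly m f g = -((g - lm m g) * f) + (f - lm m f) * g := by
    rw [hS]; ring
  have hle : ((g - lm m g) * f = 0 ∨
        m.ord.le (mdeg m ((g - lm m g) * f)) (mdeg m (sPoly m f g))) ∧
      ((f - lm m f) * g = 0 ∨
        m.ord.le (mdeg m ((f - lm m f) * g)) (mdeg m (sPoly m f g))) := by
    simp only [hS', m.mdeg_eq_degree, ← m.toMonomialOrder_toSyn_le_iff]
    by_cases hp : f - lm m f = 0
    · simp [hp]
    by_cases hq : g - lm m g = 0
    · simp [hq]
    simp only [m.mdeg_eq_degree] at hcop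
    rw [hltf] at hp ⊢
    rw [hltg] at hq ⊢
    have hne := m.toMonomialOrder.degree_sub_leadingTerm_mul_ne hcop hp hq
    rw [← MonomialOrder.degree_neg] at hne
    rw [MonomialOrder.degree_add_of_ne hne, MonomialOrder.degree_neg]
    exact ⟨.inr le_sup_left, .inr le_sup_right⟩
  refine ⟨hS, hS', hle.1, hle.2, -(g - lm m g), f - lm m f, by rw [hS', neg_mul], ?_, hle.2⟩
  simpa only [neg_mul, neg_eq_zero, m.mdeg_eq_degree, MonomialOrder.degree_neg] using hle.1
end

section
/- (Herzog) Let n₀ < n₁ < n₂ be positive integers with gcd(n₀,n₁,n₂) = 1. Then the defining ideal 𝔭(n₀,n₁,n₂) ⊆ k[x₀,x₁,x₂] is generated by at most 3 elements. -/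
open Polynomial

namespace MonomialCurve

section Monoid

variable {M : Type*} [CommMonoid M] {x y z : M} {a b c N : ℕ}

/-- Monomials in `x, y, z` of the same weight less than `N` are equal, where `x, y, z` have
weights `a, b, c`. -/
def EqBelow (x y z : M) (a b c N : ℕ) : Prop :=
  ∀ p q r p' q' r', p * a + q * b + r * c < N →
    p * a + q * b + r * c = p' * a + q' * b + r' * c →
    x ^ p * y ^ q * z ^ r = x ^ p' * y ^ q' * z ^ r'

/-- A power of `x` of weight `N` equals every monomial in `y, z` of weight `N`. -/
def PureEq (x y z : M) (a b c N : ℕ) : Prop :=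
  ∀ p q r, 0 < p → p * a = N → p * a = q * b + r * c → x ^ p = y ^ q * z ^ r

theorem EqBelow.swap (h : EqBelow x y z a b c N) : EqBelow y x z b a c N := by
  intro p q r p' q' r' hN hw
  have := h q p r q' p' r' (by omega) (by omega)
  rwa [mul_comm (x ^ q), mul_comm (x ^ q')] at this

theorem EqBelow.rotate (h : EqBelow x y z a b c N) : EqBelow y z x b c a N := by
  intro p q r p' q' r' hN hw
  have := h r p q r' p' q' (by omega) (by omega)
  rwa [mul_assoc, mul_comm, mul_assoc (x ^ r'), mul_comm (x ^ r')] at this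

theorem EqBelow.eq_of_pos_left (h : EqBelow x y z a b c N) (ha : 0 < a) {p q r p' q' r' : ℕ}
    (hp : 0 < p) (hp' : 0 < p') (hN : p * a + q * b + r * c ≤ N)
    (hw : p * a + q * b + r * c = p' * a + q' * b + r' * c) :
    x ^ p * y ^ q * z ^ r = x ^ p' * y ^ q' * z ^ r' := by
  obtain ⟨p, rfl⟩ := Nat.exists_eq_add_of_lt hp
  obtain ⟨p', rfl⟩ := Nat.exists_eq_add_of_lt hp'
  simp only [zero_add, add_one_mul] at *
  have e := h p q r p' q' r' (by omega) (by omega)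
  simp only [pow_succ', mul_assoc] at e ⊢
  rw [e]

theorem EqBelow.eq_of_pos_mid (h : EqBelow x y z a b c N) (hb : 0 < b) {p q r p' q' r' : ℕ}
    (hq : 0 < q) (hq' : 0 < q') (hN : p * a + q * b + r * c ≤ N)
    (hw : p * a + q * b + r * c = p' * a + q' * b + r' * c) :
    x ^ p * y ^ q * z ^ r = x ^ p' * y ^ q' * z ^ r' := by
  have := h.swap.eq_of_pos_left hb (q := p) (r := r) (q' := p') (r' := r') hq hq'
    (by omega) (by omega)
  rwa [mul_comm (y ^ q), mul_comm (y ^ q')] at this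

theorem EqBelow.eq_of_pos_right (h : EqBelow x y z a b c N) (hc : 0 < c) {p q r p' q' r' : ℕ}
    (hr : 0 < r) (hr' : 0 < r') (hN : p * a + q * b + r * c ≤ N)
    (hw : p * a + q * b + r * c = p' * a + q' * b + r' * c) :
    x ^ p * y ^ q * z ^ r = x ^ p' * y ^ q' * z ^ r' := by
  have := h.rotate.eq_of_pos_mid hc (p := q) (r := p) (p' := q') (r' := p') hr hr'
    (by omega) (by omega)
  rwa [mul_comm, ← mul_assoc, mul_comm _ (x ^ p'), ← mul_assoc] at this

theorem PureEq.swap (h : PureEq x y z a b c N) : PureEq x z y a c b N := by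
  intro p q r hp hN hw
  rw [mul_comm]
  exact h p r q hp hN (by omega)

/-- Monomials of equal weight are equal as soon as this holds for a pure power of one variable
against a monomial in the other two, given the claim in all smaller weights. -/
theorem monomial_eq_of_pureEq (ha : 0 < a) (hb : 0 < b) (hc : 0 < c)
    (hx : ∀ N, EqBelow x y z a b c N → PureEq x y z a b c N)
    (hy : ∀ N, EqBelow x y z a b c N → PureEq y z x b c a N)
    (hz : ∀ N, EqBelow x y z a b c N → PureEq z x y c a b N)
    (p q r p' q' r' : ℕ) (hw : p * a + q * b + r * c = p' * a + q' * b + r' * c) :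
    x ^ p * y ^ q * z ^ r = x ^ p' * y ^ q' * z ^ r' := by
  have weight_zero : ∀ {p q r : ℕ}, p * a + q * b + r * c = 0 → p = 0 ∧ q = 0 ∧ r = 0 := by
    intro p q r h
    simpa [ha.ne', hb.ne', hc.ne', and_assoc] using h
  induction hN : p * a + q * b + r * c using Nat.strong_induction_on
    generalizing p q r p' q' r' with
  | _ N ih =>
  have hlt : EqBelow x y z a b c N := fun p q r p' q' r' hlt he => ih _ hlt p q r p' q' r' he rfl
  rcases Nat.eq_zero_or_pos N with h0 | h0
  · obtain ⟨rfl, rfl, rfl⟩ := weight_zero (hN.trans h0)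
    obtain ⟨rfl, rfl, rfl⟩ := weight_zero (hw.symm.trans (hN.trans h0))
    rfl
  by_cases h1 : 0 < p ∧ 0 < p'
  · exact hlt.eq_of_pos_left ha h1.1 h1.2 hN.le hw
  by_cases h2 : 0 < q ∧ 0 < q'
  · exact hlt.eq_of_pos_mid hb h2.1 h2.2 hN.le hw
  by_cases h3 : 0 < r ∧ 0 < r'
  · exact hlt.eq_of_pos_right hc h3.1 h3.2 hN.le hw
  replace h1 : p = 0 ∨ p' = 0 := by omega
  replace h2 : q = 0 ∨ q' = 0 := by omega
  replace h3 : r = 0 ∨ r' = 0 := by omega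
  have pos : ∀ {p a : ℕ}, p * a = N → 0 < p := fun h => Nat.pos_of_mul_pos_right (h ▸ h0)
  rcases h1 with rfl | rfl <;> rcases h2 with rfl | rfl <;> rcases h3 with rfl | rfl <;>
    simp only [zero_mul, zero_add, add_zero, pow_zero, one_mul, mul_one] at hw hN ⊢
  · omega
  · rw [hz N hlt r p' q' (pos hN) hN hw]
  · rw [hy N hlt q r' p' (pos hN) hN (by omega), mul_comm]
  · rw [hx N hlt p' q r (pos (hw.symm.trans hN)) (hw.symm.trans hN) (by omega)]
  · rw [hx N hlt p q' r' (pos hN) hN hw]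
  · rw [hy N hlt q' r p (pos (hw.symm.trans hN)) (hw.symm.trans hN) (by omega), mul_comm]
  · rw [hz N hlt r' p q (pos (hw.symm.trans hN)) (hw.symm.trans hN) (by omega)]
  · omega

/-- If `u * a` is the least positive multiple of `a` that is a combination of `b` and `c`, and
`x ^ u` equals a monomial involving both `y` and `z`, then pure powers of `x` are controlled by
smaller weights. -/
theorem EqBelow.pureEq_of_full {u v w : ℕ} (h : EqBelow x y z a b c N)
    (ha : 0 < a) (hb : 0 < b) (hc : 0 < c) (hv : 0 < v) (hw : 0 < w)
    (hmin : ∀ p q r, 0 < p → p * a = q * b + r * c → u ≤ p)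
    (he : u * a = v * b + w * c) (hrel : x ^ u = y ^ v * z ^ w) :
    PureEq x y z a b c N := by
  intro p q r hp hN hpw
  obtain ⟨d, rfl⟩ := Nat.exists_eq_add_of_le (hmin p q r hp hpw)
  rw [add_mul] at hN hpw
  have e : x ^ (u + d) = x ^ d * y ^ v * z ^ w := by
    rw [pow_add, hrel, mul_comm, mul_assoc]
  have e' : y ^ q * z ^ r = x ^ 0 * y ^ q * z ^ r := by simp
  have hqr : 0 < q ∨ 0 < r := by
    by_contra! h0
    have := Nat.mul_pos hv hb
    simp [show q = 0 by omega, show r = 0 by omega] at hpw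
    omega
  rw [e, e']
  rcases hqr with hq | hr
  · exact h.eq_of_pos_mid hb hv hq (by omega) (by omega)
  · exact h.eq_of_pos_right hc hw hr (by omega) (by omega)

/-- Pure powers of `x` are controlled by smaller weights when `x ^ u = y ^ v` and pure powers of
`z` are. -/
theorem EqBelow.pureEq_of_binary {u v : ℕ} (h : EqBelow x y z a b c N)
    (ha : 0 < a) (hb : 0 < b) (hv : 0 < v)
    (hmin : ∀ p q r, 0 < p → p * a = q * b + r * c → u ≤ p)
    (he : u * a = v * b) (hrel : x ^ u = y ^ v) (hz : PureEq z x y c a b N) :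
    PureEq x y z a b c N := by
  intro p q r hp hN hpw
  rcases Nat.eq_zero_or_pos q with rfl | hq
  · rw [pow_zero, one_mul]
    have hr : 0 < r := by
      rcases Nat.eq_zero_or_pos r with rfl | hr
      · have := Nat.mul_pos hp ha
        omega
      · exact hr
    simpa using (hz r p 0 hr (by omega) (by omega)).symm
  · obtain ⟨d, rfl⟩ := Nat.exists_eq_add_of_le (hmin p q r hp hpw)
    rw [add_mul] at hN hpw
    have e : x ^ (u + d) = x ^ d * y ^ v * z ^ 0 := by
      rw [pow_add, hrel, mul_comm, pow_zero, mul_one]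
    have e' : y ^ q * z ^ r = x ^ 0 * y ^ q * z ^ r := by simp
    rw [e, e']
    exact h.eq_of_pos_mid hb hv hq (by omega) (by omega)

/-- Pure powers of `z` are controlled by smaller weights when `x ^ u = y ^ v` and
`z ^ s = x ^ t * y ^ w` with `u, v, s` minimal. -/
theorem EqBelow.pureEq_of_complete {u v s t w : ℕ} (h : EqBelow x y z a b c N)
    (ha : 0 < a) (hb : 0 < b) (hc : 0 < c) (hu : 0 < u) (hv : 0 < v) (hs : 0 < s)
    (hminx : ∀ p q r, 0 < p → p * a = q * b + r * c → u ≤ p)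
    (hminy : ∀ p q r, 0 < p → p * b = q * c + r * a → v ≤ p)
    (hminz : ∀ p q r, 0 < p → p * c = q * a + r * b → s ≤ p)
    (hxy : u * a = v * b) (hrel : x ^ u = y ^ v)
    (hzw : s * c = t * a + w * b) (hrelz : z ^ s = x ^ t * y ^ w) :
    PureEq z x y c a b N := by
  intro r p q hr hN hpw
  have hpw' := hpw
  obtain ⟨d, rfl⟩ := Nat.exists_eq_add_of_le (hminz r p q hr hpw)
  have hsc := Nat.mul_pos hs hc
  rw [add_mul] at hN hpw
  have e : z ^ (s + d) = x ^ t * y ^ w * z ^ d := by rw [pow_add, hrelz]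
  have e' : x ^ p * y ^ q = x ^ p * y ^ q * z ^ 0 := by simp
  rw [e, e']
  by_cases h1 : 0 < t ∧ 0 < p
  · exact h.eq_of_pos_left ha h1.1 h1.2 (by omega) (by omega)
  by_cases h2 : 0 < w ∧ 0 < q
  · exact h.eq_of_pos_mid hb h2.1 h2.2 (by omega) (by omega)
  rcases Nat.eq_zero_or_pos t with rfl | ht
  · have hw : 0 < w := Nat.pos_of_ne_zero (by rintro rfl; omega)
    obtain rfl : q = 0 := by omega
    have hp : 0 < p := Nat.pos_of_ne_zero (by rintro rfl; omega)
    obtain ⟨f, rfl⟩ := Nat.exists_eq_add_of_le (hminx p 0 (s + d) hp (by omega))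
    rw [add_mul] at hpw
    have e'' : x ^ (u + f) * y ^ 0 * z ^ 0 = x ^ f * y ^ v * z ^ 0 := by
      rw [pow_add, hrel, mul_comm (y ^ v)]; simp
    rw [e'']
    exact h.eq_of_pos_mid hb hw hv (by omega) (by omega)
  · obtain rfl : p = 0 := by omega
    have hq : 0 < q := Nat.pos_of_ne_zero (by rintro rfl; omega)
    obtain ⟨f, rfl⟩ := Nat.exists_eq_add_of_le (hminy q (s + d) 0 hq (by omega))
    rw [add_mul] at hpw
    have e'' : x ^ 0 * y ^ (v + f) * z ^ 0 = x ^ u * y ^ f * z ^ 0 := by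
      rw [pow_add, ← hrel]; simp
    rw [e'']
    exact h.eq_of_pos_left ha ht hu (by omega) (by omega)

end Monoid

section Ring

variable {A : Type*} [CommRing A]

/-- The ideal generated by the binomials in `x, y, z` that are homogeneous for the weights
`a, b, c` is generated by at most three such binomials. -/
def ThreeBinomials (x y z : A) (a b c : ℕ) : Prop :=
  ∃ s : Finset A, s.card ≤ 3 ∧
    (∀ g ∈ s, ∃ p q r p' q' r' : ℕ, p * a + q * b + r * c = p' * a + q' * b + r' * c ∧
      g = x ^ p * y ^ q * z ^ r - x ^ p' * y ^ q' * z ^ r') ∧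
    ∀ p q r p' q' r' : ℕ, p * a + q * b + r * c = p' * a + q' * b + r' * c →
      x ^ p * y ^ q * z ^ r - x ^ p' * y ^ q' * z ^ r' ∈ Ideal.span (s : Set A)

variable {x y z : A} {a b c : ℕ}

theorem ThreeBinomials.rotate (h : ThreeBinomials x y z a b c) : ThreeBinomials y z x b c a := by
  obtain ⟨s, hs, hg, hmem⟩ := h
  refine ⟨s, hs, fun g hgs => ?_, fun p q r p' q' r' hw => ?_⟩
  · obtain ⟨p, q, r, p', q', r', hw, rfl⟩ := hg g hgs
    exact ⟨q, r, p, q', r', p', by omega, by ring⟩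
  · convert hmem r p q r' p' q' (by omega) using 1
    ring

theorem ThreeBinomials.swap (h : ThreeBinomials x y z a b c) : ThreeBinomials x z y a c b := by
  obtain ⟨s, hs, hg, hmem⟩ := h
  refine ⟨s, hs, fun g hgs => ?_, fun p q r p' q' r' hw => ?_⟩
  · obtain ⟨p, q, r, p', q', r', hw, rfl⟩ := hg g hgs
    exact ⟨p, r, q, p', r', q', by omega, by ring⟩
  · convert hmem p r q p' r' q' (by omega) using 1
    ring

/-- `u * a` is the least positive multiple of `a` that is a combination of `b` and `c`. -/
def IsLeastMultiple (a b c u : ℕ) : Prop :=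
  0 < u ∧ (∃ v w, u * a = v * b + w * c) ∧ ∀ p q r, 0 < p → p * a = q * b + r * c → u ≤ p

theorem IsLeastMultiple.swap {u : ℕ} (h : IsLeastMultiple a b c u) : IsLeastMultiple a c b u := by
  obtain ⟨hu, ⟨v, w, e⟩, hmin⟩ := h
  exact ⟨hu, ⟨w, v, by omega⟩, fun p q r hp he => hmin p r q hp (by omega)⟩

theorem exists_isLeastMultiple (a c : ℕ) {b : ℕ} (hb : 0 < b) : ∃ u, IsLeastMultiple a b c u := by
  classical
  have h : ∃ u, 0 < u ∧ ∃ v w, u * a = v * b + w * c := ⟨b, hb, a, 0, by ring⟩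
  exact ⟨Nat.find h, (Nat.find_spec h).1, (Nat.find_spec h).2,
    fun p q r hp he => Nat.find_min' h ⟨hp, q, r, he⟩⟩

theorem threeBinomials_of_full {u₁ v₁ w₁ u₂ v₂ w₂ u₃ v₃ w₃ : ℕ}
    (ha : 0 < a) (hb : 0 < b) (hc : 0 < c)
    (h₁ : IsLeastMultiple a b c u₁) (h₂ : IsLeastMultiple b c a u₂)
    (h₃ : IsLeastMultiple c a b u₃)
    (hv₁ : 0 < v₁) (hw₁ : 0 < w₁) (e₁ : u₁ * a = v₁ * b + w₁ * c)
    (hv₂ : 0 < v₂) (hw₂ : 0 < w₂) (e₂ : u₂ * b = v₂ * c + w₂ * a)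
    (hv₃ : 0 < v₃) (hw₃ : 0 < w₃) (e₃ : u₃ * c = v₃ * a + w₃ * b) :
    ThreeBinomials x y z a b c := by
  classical
  refine ⟨{x ^ u₁ - y ^ v₁ * z ^ w₁, y ^ u₂ - z ^ v₂ * x ^ w₂, z ^ u₃ - x ^ v₃ * y ^ w₃},
    Finset.card_le_three, ?_, fun p q r p' q' r' hw => ?_⟩
  · simp only [Finset.mem_insert, Finset.mem_singleton]
    rintro g (rfl | rfl | rfl)
    · exact ⟨u₁, 0, 0, 0, v₁, w₁, by omega, by ring⟩
    · exact ⟨0, u₂, 0, w₂, 0, v₂, by omega, by ring⟩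
    · exact ⟨0, 0, u₃, v₃, w₃, 0, by omega, by ring⟩
  · rw [← Ideal.Quotient.eq]
    set I := Ideal.span (↑({x ^ u₁ - y ^ v₁ * z ^ w₁, y ^ u₂ - z ^ v₂ * x ^ w₂,
      z ^ u₃ - x ^ v₃ * y ^ w₃} : Finset A) : Set A)
    have r₁ : Ideal.Quotient.mk I (x ^ u₁) = Ideal.Quotient.mk I (y ^ v₁ * z ^ w₁) :=
      Ideal.Quotient.eq.2 (Ideal.subset_span (by simp))
    have r₂ : Ideal.Quotient.mk I (y ^ u₂) = Ideal.Quotient.mk I (z ^ v₂ * x ^ w₂) :=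
      Ideal.Quotient.eq.2 (Ideal.subset_span (by simp))
    have r₃ : Ideal.Quotient.mk I (z ^ u₃) = Ideal.Quotient.mk I (x ^ v₃ * y ^ w₃) :=
      Ideal.Quotient.eq.2 (Ideal.subset_span (by simp))
    simp only [map_mul, map_pow] at r₁ r₂ r₃ ⊢
    exact monomial_eq_of_pureEq ha hb hc
      (fun N h => h.pureEq_of_full ha hb hc hv₁ hw₁ h₁.2.2 e₁ r₁)
      (fun N h => h.rotate.pureEq_of_full hb hc ha hv₂ hw₂ h₂.2.2 e₂ r₂)
      (fun N h => h.rotate.rotate.pureEq_of_full hc ha hb hv₃ hw₃ h₃.2.2 e₃ r₃) p q r p' q' r' hw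

theorem threeBinomials_of_binary {u v s : ℕ} (ha : 0 < a) (hb : 0 < b) (hc : 0 < c)
    (h₁ : IsLeastMultiple a b c u) (h₂ : IsLeastMultiple b c a v)
    (h₃ : IsLeastMultiple c a b s) (e : u * a = v * b) :
    ThreeBinomials x y z a b c := by
  classical
  obtain ⟨hs, ⟨t, w, e₃⟩, hmin₃⟩ := h₃
  refine ⟨{x ^ u - y ^ v, z ^ s - x ^ t * y ^ w},
    Finset.card_le_two.trans (by norm_num), ?_, fun p q r p' q' r' hw => ?_⟩
  · simp only [Finset.mem_insert, Finset.mem_singleton]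
    rintro g (rfl | rfl)
    · exact ⟨u, 0, 0, 0, v, 0, by omega, by ring⟩
    · exact ⟨0, 0, s, t, w, 0, by omega, by ring⟩
  · rw [← Ideal.Quotient.eq]
    set I := Ideal.span (↑({x ^ u - y ^ v, z ^ s - x ^ t * y ^ w} : Finset A) : Set A)
    have r₁ : Ideal.Quotient.mk I (x ^ u) = Ideal.Quotient.mk I (y ^ v) :=
      Ideal.Quotient.eq.2 (Ideal.subset_span (by simp))
    have r₃ : Ideal.Quotient.mk I (z ^ s) = Ideal.Quotient.mk I (x ^ t * y ^ w) :=
      Ideal.Quotient.eq.2 (Ideal.subset_span (by simp))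
    simp only [map_mul, map_pow] at r₁ r₃ ⊢
    have hz := fun N (h : EqBelow (Ideal.Quotient.mk I x) (Ideal.Quotient.mk I y)
        (Ideal.Quotient.mk I z) a b c N) =>
      h.pureEq_of_complete ha hb hc h₁.1 h₂.1 hs h₁.2.2 h₂.2.2 hmin₃ e r₁ e₃ r₃
    exact monomial_eq_of_pureEq ha hb hc
      (fun N h => h.pureEq_of_binary ha hb h₂.1 h₁.2.2 e r₁ (hz N h))
      (fun N h => (h.swap.pureEq_of_binary hb ha h₁.1 h₂.swap.2.2 e.symm r₁.symm
        (hz N h).swap).swap) hz p q r p' q' r' hw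

/-- If the least multiple of `a` in the semigroup of `b, c` is a multiple of `b` and is not a
combination of `b, c` with positive coefficients, it is the least multiple of `b` as well. -/
theorem IsLeastMultiple.eq_of_not_full {u v t : ℕ} (ha : 0 < a) (hb : 0 < b)
    (h₁ : IsLeastMultiple a b c u) (h₂ : IsLeastMultiple b c a v)
    (hfull : ¬ ∃ q r, 0 < q ∧ 0 < r ∧ u * a = q * b + r * c) (e : u * a = t * b) : t = v := by
  obtain ⟨hu, -, hmin₁⟩ := h₁
  obtain ⟨hv, ⟨r, p, e₂⟩, hmin₂⟩ := h₂
  have hua := Nat.mul_pos hu ha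
  have ht : 0 < t := Nat.pos_of_ne_zero (by rintro rfl; omega)
  obtain ⟨d, rfl⟩ := Nat.exists_eq_add_of_le (hmin₂ t 0 u ht (by omega))
  by_contra hd
  have hd : 0 < d := by omega
  have hdb := Nat.mul_pos hd hb
  rw [add_mul] at e
  have hpu : p < u := by
    by_contra! hle
    have := Nat.mul_le_mul_right a hle
    omega
  obtain ⟨f, rfl⟩ := Nat.exists_eq_add_of_lt hpu
  have hsplit : (p + f + 1) * a = p * a + (f + 1) * a := by ring
  have hp := hmin₁ (f + 1) d r f.succ_pos (by omega)
  obtain rfl : p = 0 := by omega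
  have hvb := Nat.mul_pos hv hb
  refine hfull ⟨d, r, hd, Nat.pos_of_ne_zero (by rintro rfl; omega), by omega⟩

theorem threeBinomials_of_not_full {u : ℕ} (ha : 0 < a) (hb : 0 < b) (hc : 0 < c)
    (h₁ : IsLeastMultiple a b c u)
    (hfull : ¬ ∃ q r, 0 < q ∧ 0 < r ∧ u * a = q * b + r * c) : ThreeBinomials x y z a b c := by
  obtain ⟨v, h₂⟩ := exists_isLeastMultiple b a hc
  obtain ⟨s, h₃⟩ := exists_isLeastMultiple c b ha
  obtain ⟨q, r, e⟩ := h₁.2.1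
  rcases Nat.eq_zero_or_pos r with rfl | hr
  · have e' : u * a = q * b := by omega
    obtain rfl := h₁.eq_of_not_full ha hb h₂ hfull e'
    exact threeBinomials_of_binary ha hb hc h₁ h₂ h₃ e'
  · obtain rfl : q = 0 := by
      by_contra hq
      exact hfull ⟨q, r, by omega, hr, e⟩
    have e' : u * a = r * c := by omega
    obtain rfl := h₁.swap.eq_of_not_full ha hc h₃.swap
      (fun ⟨q, r, hq, hr, e⟩ => hfull ⟨r, q, hr, hq, by omega⟩) e'
    exact (threeBinomials_of_binary ha hc hb h₁.swap h₃.swap h₂.swap e').swap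

theorem threeBinomials (x y z : A) (ha : 0 < a) (hb : 0 < b) (hc : 0 < c) :
    ThreeBinomials x y z a b c := by
  obtain ⟨u₁, h₁⟩ := exists_isLeastMultiple a c hb
  obtain ⟨u₂, h₂⟩ := exists_isLeastMultiple b a hc
  obtain ⟨u₃, h₃⟩ := exists_isLeastMultiple c b ha
  by_cases f₁ : ∃ q r, 0 < q ∧ 0 < r ∧ u₁ * a = q * b + r * c
  swap
  · exact threeBinomials_of_not_full ha hb hc h₁ f₁
  by_cases f₂ : ∃ q r, 0 < q ∧ 0 < r ∧ u₂ * b = q * c + r * a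
  swap
  · exact (threeBinomials_of_not_full hb hc ha h₂ f₂).rotate.rotate
  by_cases f₃ : ∃ q r, 0 < q ∧ 0 < r ∧ u₃ * c = q * a + r * b
  swap
  · exact (threeBinomials_of_not_full hc ha hb h₃ f₃).rotate
  obtain ⟨v₁, w₁, hv₁, hw₁, e₁⟩ := f₁
  obtain ⟨v₂, w₂, hv₂, hw₂, e₂⟩ := f₂
  obtain ⟨v₃, w₃, hv₃, hw₃, e₃⟩ := f₃
  exact threeBinomials_of_full ha hb hc h₁ h₂ h₃ hv₁ hw₁ e₁ hv₂ hw₂ e₂ hv₃ hw₃ e₃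

end Ring

/-- An ideal containing all differences of monomials of equal weight contains the kernel of the
monomial parametrization. -/
theorem ker_aeval_le {k σ : Type*} [Field k] (n : σ → ℕ) (I : Ideal (MvPolynomial σ k))
    (hI : ∀ m m' : σ →₀ ℕ, Finsupp.weight n m = Finsupp.weight n m' →
      MvPolynomial.monomial m (1 : k) - MvPolynomial.monomial m' 1 ∈ I) :
    RingHom.ker (MvPolynomial.aeval (R := k) fun i => (X : k[X]) ^ n i).toRingHom ≤ I := by
  classical
  let g : ℕ → MvPolynomial σ k ⧸ I := fun N =>
    if h : ∃ m : σ →₀ ℕ, Finsupp.weight n m = N then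
      Ideal.Quotient.mk I (MvPolynomial.monomial h.choose 1) else 0
  let L : k[X] →ₗ[k] MvPolynomial σ k ⧸ I := (Polynomial.basisMonomials k).constr k g
  have hL : L ∘ₗ (MvPolynomial.aeval (R := k) fun i => (X : k[X]) ^ n i).toLinearMap =
      (Ideal.Quotient.mkₐ k I).toLinearMap := by
    refine MvPolynomial.linearMap_ext fun m => LinearMap.ext_ring ?_
    have hm : ∃ m' : σ →₀ ℕ, Finsupp.weight n m' = Finsupp.weight n m := ⟨m, rfl⟩
    have h1 : MvPolynomial.aeval (R := k) (fun i => (X : k[X]) ^ n i)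
        (MvPolynomial.monomial m 1) = Polynomial.basisMonomials k (Finsupp.weight n m) := by
      simp [MvPolynomial.aeval_monomial, Finsupp.weight_apply, Finsupp.prod, Finsupp.sum,
        ← pow_mul, Finset.prod_pow_eq_pow_sum, mul_comm, Polynomial.monomial_one_right_eq_X_pow]
    simp only [LinearMap.comp_apply, AlgHom.toLinearMap_apply, h1, L, Module.Basis.constr_basis, g,
      dif_pos hm]
    exact Ideal.Quotient.eq.2 (hI _ _ hm.choose_spec)
  intro f hf
  have hf0 : MvPolynomial.aeval (R := k) (fun i => (X : k[X]) ^ n i) f = 0 := hf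
  have := LinearMap.congr_fun hL f
  simp only [LinearMap.comp_apply, AlgHom.toLinearMap_apply, hf0, map_zero] at this
  exact Ideal.Quotient.eq_zero_iff_mem.1 this.symm

end MonomialCurve

/-- **Herzog.** Let `n₀ < n₁ < n₂` be positive integers with
`gcd(n₀,n₁,n₂) = 1`.  The defining ideal `𝔭(n₀,n₁,n₂) ⊆ k[x₀,x₁,x₂]` of the monomial
space curve is generated by at most `3` elements. -/
theorem herzog_three_generators (k : Type*) [Field k] (n : Fin 3 → ℕ)
    (hpos : ∀ i, 0 < n i) (hmono : StrictMono n)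
    (hgcd : ∀ d : ℕ, (∀ i, d ∣ n i) → d = 1) :
    ∃ s : Finset (MvPolynomial (Fin 3) k), s.card ≤ 3 ∧
      Ideal.span (s : Set (MvPolynomial (Fin 3) k)) =
        RingHom.ker (MvPolynomial.aeval (R := k) fun i => (X : k[X]) ^ n i).toRingHom := by
  obtain ⟨s, hs, hg, hmem⟩ := MonomialCurve.threeBinomials
    (MvPolynomial.X 0 : MvPolynomial (Fin 3) k) (MvPolynomial.X 1) (MvPolynomial.X 2)
    (hpos 0) (hpos 1) (hpos 2)
  refine ⟨s, hs, le_antisymm (Ideal.span_le.2 fun g hgs => ?_)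
    (MonomialCurve.ker_aeval_le n _ fun m m' hw => ?_)⟩
  · obtain ⟨p, q, r, p', q', r', hw, rfl⟩ := hg g hgs
    change MvPolynomial.aeval (R := k) (fun i => (X : k[X]) ^ n i) _ = 0
    simp only [map_sub, map_mul, map_pow, MvPolynomial.aeval_X, ← pow_mul, ← pow_add]
    rw [sub_eq_zero]
    congr 1
    linarith
  · have hX : ∀ m : Fin 3 →₀ ℕ, MvPolynomial.monomial m (1 : k) =
        MvPolynomial.X 0 ^ m 0 * MvPolynomial.X 1 ^ m 1 * MvPolynomial.X 2 ^ m 2 := fun m => by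
      rw [MvPolynomial.monomial_eq, Finsupp.prod_fintype _ _ (by simp), Fin.prod_univ_three]
      simp
    have hW : ∀ m : Fin 3 →₀ ℕ,
        Finsupp.weight n m = m 0 * n 0 + m 1 * n 1 + m 2 * n 2 := fun m => by
      rw [Finsupp.weight_apply, Finsupp.sum_fintype _ _ (by simp), Fin.sum_univ_three]
      simp
    rw [hX, hX]
    exact hmem _ _ _ _ _ _ (by rw [← hW, ← hW, hw])
end

section
/- (Bresinsky) For the Bresinsky sequence n₁ = q₁q₂, n₂ = q₁d₁, n₃ = q₁q₂ + d₁, n₄ = q₂d₁, the defining ideal 𝔭(n₁,n₂,n₃,n₄) ⊆ k[x₁,x₂,x₃,x₄] equals the ideal generated by the set S = A₁ ∪ A₂' ∪ {g₁, g₂}, where A₁ = {f_μ = x₁^{μ−1} x₃^{q₂−μ} − x₂^{q₂−μ} x₄^{μ+1} : 1 ≤ μ ≤ q₂}, A₂' = {h_m = x₁^{m} x₄^{q₁−m} − x₂^{q₂−m} x₃^{m} : 1 ≤ m ≤ q₂−2}, g₁ = x₁^{d₁} − x₂^{q₂}, and g₂ = x₃x₄ − x₁x₂. -/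
open Polynomial

/-- If any two monomials of equal weight agree modulo `I`, then `I` contains the kernel of the
monomial parametrization `x i ↦ t ^ n i`. -/
theorem ker_aeval_X_pow_le {σ k : Type*} [CommRing k] (n : σ → ℕ)
    (I : Ideal (MvPolynomial σ k))
    (h : ∀ u v : σ →₀ ℕ, Finsupp.weight n u = Finsupp.weight n v →
      Ideal.Quotient.mk I (MvPolynomial.monomial u 1) =
        Ideal.Quotient.mk I (MvPolynomial.monomial v 1)) :
    RingHom.ker (MvPolynomial.aeval (R := k) fun i => (X : k[X]) ^ n i).toRingHom ≤ I := by
  let s : k[X] →ₗ[k] MvPolynomial σ k ⧸ I := (Polynomial.basisMonomials k).constr k fun N =>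
    Ideal.Quotient.mk I (MvPolynomial.monomial (Function.invFun (Finsupp.weight n) N) 1)
  have hs : s ∘ₗ (MvPolynomial.aeval (R := k) fun i => (X : k[X]) ^ n i).toLinearMap =
      (Ideal.Quotient.mkₐ k I).toLinearMap := by
    refine MvPolynomial.linearMap_ext fun u => LinearMap.ext_ring ?_
    have hu : (u.prod fun i e => ((X : k[X]) ^ n i) ^ e) =
        Polynomial.basisMonomials k (Finsupp.weight n u) := by
      simp only [Polynomial.coe_basisMonomials, Polynomial.monomial_one_right_eq_X_pow,
        Finsupp.weight_apply, Finsupp.sum, Finsupp.prod, ← pow_mul, Finset.prod_pow_eq_pow_sum,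
        smul_eq_mul, mul_comm]
    simp only [LinearMap.comp_apply, AlgHom.toLinearMap_apply, MvPolynomial.aeval_monomial, map_one,
      one_mul, hu, s, Module.Basis.constr_basis, Ideal.Quotient.mkₐ_eq_mk]
    exact h _ _ (Function.invFun_eq ⟨u, rfl⟩)
  intro p hp
  have hp' : MvPolynomial.aeval (R := k) (fun i => (X : k[X]) ^ n i) p = 0 := hp
  have := LinearMap.congr_fun hs p
  simp only [LinearMap.comp_apply, AlgHom.toLinearMap_apply, hp', map_zero,
    Ideal.Quotient.mkₐ_eq_mk] at this
  exact Ideal.Quotient.eq_zero_iff_mem.mp this.symm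

/-- The exponents `(b, c, e)` of the standard monomials `x₂ ^ b * x₃ ^ c * x₄ ^ e`. -/
def IsBresinskyStandard (q b c e : ℕ) : Prop :=
  c = 0 ∧ b < q ∧ e ≤ q ∧ (e ≤ 2 ∨ b + e ≤ q) ∨ e = 0 ∧ 1 ≤ c ∧ c ≤ q - 2 ∧ b + c < q

/-- Modulo the Bresinsky relations, every monomial is a power of `x` times a standard one. -/
theorem exists_isBresinskyStandard {R : Type*} [CommRing R] {q : ℕ} (hq : 4 ≤ q) {x y z w : R}
    (hf : ∀ μ, 1 ≤ μ → μ ≤ q → x ^ (μ - 1) * z ^ (q - μ) = y ^ (q - μ) * w ^ (μ + 1))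
    (hh : ∀ m, 1 ≤ m → m ≤ q - 2 → x ^ m * w ^ (q + 1 - m) = y ^ (q - m) * z ^ m)
    (hg₁ : x ^ (q - 1) = y ^ q) (hg₂ : z * w = x * y) (a b c e : ℕ) :
    ∃ a' b' c' e', IsBresinskyStandard q b' c' e' ∧
      x ^ a * y ^ b * z ^ c * w ^ e = x ^ a' * y ^ b' * z ^ c' * w ^ e' := by
  induction hN : (q + 1) * b + (q + 4) * c + q * e using Nat.strong_induction_on
    generalizing a b c e with
  | _ N ih =>
  subst hN
  have step : ∀ a' b' c' e', x ^ a * y ^ b * z ^ c * w ^ e = x ^ a' * y ^ b' * z ^ c' * w ^ e' →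
      (q + 1) * b' + (q + 4) * c' + q * e' < (q + 1) * b + (q + 4) * c + q * e →
      ∃ a' b' c' e', IsBresinskyStandard q b' c' e' ∧
        x ^ a * y ^ b * z ^ c * w ^ e = x ^ a' * y ^ b' * z ^ c' * w ^ e' := by
    intro a' b' c' e' heq hlt
    rw [heq]
    exact ih _ hlt a' b' c' e' rfl
  by_cases hzw : 1 ≤ c ∧ 1 ≤ e
  · obtain ⟨⟨c, rfl⟩, ⟨e, rfl⟩⟩ := hzw.imp Nat.exists_eq_add_of_le Nat.exists_eq_add_of_le
    refine step (a + 1) (b + 1) c e ?_ (by nlinarith)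
    linear_combination x ^ a * y ^ b * z ^ c * w ^ e * hg₂
  by_cases hb : q ≤ b
  · obtain ⟨b, rfl⟩ := Nat.exists_eq_add_of_le hb
    refine step (a + (q - 1)) b c e ?_ (by nlinarith)
    linear_combination -x ^ a * y ^ b * z ^ c * w ^ e * hg₁
  by_cases he : q + 1 ≤ e
  · obtain ⟨e, rfl⟩ := Nat.exists_eq_add_of_le he
    refine step (a + (q - 1)) b c e ?_ (by nlinarith)
    have h := hf q (by lia) le_rfl
    rw [Nat.sub_self] at h
    linear_combination -x ^ a * y ^ b * z ^ c * w ^ e * h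
  by_cases hc : q - 1 ≤ c
  · obtain ⟨c, rfl⟩ := Nat.exists_eq_add_of_le hc
    refine step a (b + (q - 1)) c (e + 2) ?_ ?_
    · linear_combination x ^ a * y ^ b * z ^ c * w ^ e * hf 1 le_rfl (by lia)
    · obtain ⟨r, rfl⟩ := Nat.exists_eq_add_of_le hq
      rw [show 4 + r - 1 = 3 + r by lia]
      nlinarith
  by_cases hyw : 3 ≤ e ∧ q + 1 ≤ b + e
  · obtain ⟨he3, hbe⟩ := hyw
    obtain ⟨b, rfl⟩ := Nat.exists_eq_add_of_le (show q + 1 - e ≤ b by lia)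
    refine step (a + (e - 2)) b (c + (q + 1 - e)) 0 ?_ ?_
    · have h := hf (e - 1) (by lia) (by lia)
      rw [show e - 1 - 1 = e - 2 by lia, show q - (e - 1) = q + 1 - e by lia,
        show e - 1 + 1 = e by lia] at h
      linear_combination -x ^ a * y ^ b * z ^ c * h
    · generalize hr : q + 1 - e = r
      have : 3 * r < q * e := by nlinarith
      nlinarith
  by_cases hyz : 1 ≤ c ∧ q ≤ b + c
  · obtain ⟨hc1, hbc⟩ := hyz
    obtain ⟨b, rfl⟩ := Nat.exists_eq_add_of_le (show q - c ≤ b by lia)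
    refine step (a + c) b 0 (e + (q + 1 - c)) ?_ ?_
    · linear_combination -x ^ a * y ^ b * w ^ e * hh c hc1 (by lia)
    · obtain ⟨r, rfl⟩ := Nat.exists_eq_add_of_le (show c ≤ q by lia)
      rw [show c + r + 1 - c = r + 1 by lia, show c + r - c = r by lia]
      nlinarith
  exact ⟨a, b, c, e, by unfold IsBresinskyStandard; lia, rfl⟩

/-- A power of `x₁` times a standard monomial is determined by its weight. -/
theorem IsBresinskyStandard.eq_of_weight_eq {q : ℕ} (hq : 4 ≤ q) (heven : Even q)
    {a b c e a' b' c' e' : ℕ} (h : IsBresinskyStandard q b c e)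
    (h' : IsBresinskyStandard q b' c' e')
    (hw : a * ((q + 1) * q) + b * ((q + 1) * (q - 1)) + c * ((q + 1) * q + (q - 1)) +
        e * (q * (q - 1)) =
      a' * ((q + 1) * q) + b' * ((q + 1) * (q - 1)) + c' * ((q + 1) * q + (q - 1)) +
        e' * (q * (q - 1))) :
    a = a' ∧ b = b' ∧ c = c' ∧ e = e' := by
  unfold IsBresinskyStandard at h h'
  have hsum : b + c = b' + c' := by
    have hdvd : (q : ℤ) ∣ (b + c) - (b' + c') := by
      zify [show 1 ≤ q by lia] at hw
      refine ⟨(a - a') * (q + 1) + (b - b') * q + (c - c') * (q + 2) + (e - e') * (q - 1), ?_⟩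
      linear_combination -hw
    have := Int.eq_zero_of_abs_lt_dvd hdvd (by rw [abs_lt]; lia)
    lia
  have hdvd : ((q : ℤ) + 1) ∣ (e - c) - (e' - c') := by
    have hdvd₂ : ((q : ℤ) + 1) ∣ 2 * ((e - c) - (e' - c')) := by
      zify [show 1 ≤ q by lia] at hw
      refine ⟨-((a - a') * q + (b - b') * (q - 1) + (c - c') * (q + 1) + (e - e') * (q - 2)), ?_⟩
      linear_combination hw
    refine IsCoprime.dvd_of_dvd_mul_left ?_ hdvd₂
    obtain ⟨r, rfl⟩ := heven
    exact ⟨1, -r, by push_cast; ring⟩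
  obtain ⟨t, ht⟩ := hdvd
  have hlt : (e - c : ℤ) - (e' - c') < 2 * (q + 1) := by lia
  have hgt : -(2 * (q + 1)) < (e - c : ℤ) - (e' - c') := by lia
  have ht1 : t < 2 := by nlinarith
  have ht2 : -2 < t := by nlinarith
  have hbce : b = b' ∧ c = c' ∧ e = e' := by
    obtain rfl | rfl | rfl : t = -1 ∨ t = 0 ∨ t = 1 := by lia
    all_goals lia
  obtain ⟨rfl, rfl, rfl⟩ := hbce
  have : a * ((q + 1) * q) = a' * ((q + 1) * q) := by lia
  exact ⟨Nat.eq_of_mul_eq_mul_right (by positivity) this, rfl, rfl, rfl⟩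

/-- **Bresinsky.** Let `q₂ ≥ 4` be even, `q₁ = q₂ + 1`, `d₁ = q₂ − 1`,
and `n₁ = q₁q₂`, `n₂ = q₁d₁`, `n₃ = q₁q₂ + d₁`, `n₄ = q₂d₁`.  The defining ideal
`𝔭(n₁,n₂,n₃,n₄) ⊆ k[x₁,x₂,x₃,x₄]` equals the ideal generated by
`S = A₁ ∪ A₂' ∪ {g₁, g₂}`, where
`A₁ = {x₁^{μ−1}x₃^{q₂−μ} − x₂^{q₂−μ}x₄^{μ+1} : 1 ≤ μ ≤ q₂}`,
`A₂' = {x₁^m x₄^{q₁−m} − x₂^{q₂−m}x₃^m : 1 ≤ m ≤ q₂−2}`,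
`g₁ = x₁^{d₁} − x₂^{q₂}` and `g₂ = x₃x₄ − x₁x₂`.
(The variables `x₁,x₂,x₃,x₄` are the `MvPolynomial.X` indexed by `0,1,2,3 : Fin 4`.) -/
theorem bresinsky_generators (k : Type*) [Field k] (q₂ : ℕ) (hq : 4 ≤ q₂)
    (heven : Even q₂) :
    letI q₁ : ℕ := q₂ + 1
    letI d₁ : ℕ := q₂ - 1
    letI n : Fin 4 → ℕ := ![q₁ * q₂, q₁ * d₁, q₁ * q₂ + d₁, q₂ * d₁]
    RingHom.ker (MvPolynomial.aeval (R := k) fun i => (X : k[X]) ^ n i).toRingHom =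
      Ideal.span
        ({f : MvPolynomial (Fin 4) k | ∃ μ : ℕ, 1 ≤ μ ∧ μ ≤ q₂ ∧
            f = MvPolynomial.X 0 ^ (μ - 1) * MvPolynomial.X 2 ^ (q₂ - μ) -
                MvPolynomial.X 1 ^ (q₂ - μ) * MvPolynomial.X 3 ^ (μ + 1)} ∪
         {f : MvPolynomial (Fin 4) k | ∃ m : ℕ, 1 ≤ m ∧ m ≤ q₂ - 2 ∧
            f = MvPolynomial.X 0 ^ m * MvPolynomial.X 3 ^ (q₁ - m) -
                MvPolynomial.X 1 ^ (q₂ - m) * MvPolynomial.X 2 ^ m} ∪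
         {MvPolynomial.X 0 ^ d₁ - MvPolynomial.X 1 ^ q₂,
          MvPolynomial.X 2 * MvPolynomial.X 3 - MvPolynomial.X 0 * MvPolynomial.X 1}) := by
  set J : Ideal (MvPolynomial (Fin 4) k) := Ideal.span _
  set n : Fin 4 → ℕ :=
    ![(q₂ + 1) * q₂, (q₂ + 1) * (q₂ - 1), (q₂ + 1) * q₂ + (q₂ - 1), q₂ * (q₂ - 1)]
  have hle : J ≤ RingHom.ker (MvPolynomial.aeval (R := k) fun i => (X : k[X]) ^ n i).toRingHom := by
    have hq1 : 1 ≤ q₂ := by lia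
    rw [Ideal.span_le]
    rintro f ((⟨μ, hμ1, hμ, rfl⟩ | ⟨m, hm1, hm, rfl⟩) | rfl | rfl) <;>
      simp only [SetLike.mem_coe, RingHom.mem_ker, AlgHom.toRingHom_eq_coe, RingHom.coe_coe,
        map_sub, map_mul, map_pow, MvPolynomial.aeval_X, sub_eq_zero, ← pow_mul, ← pow_add] <;>
      congr 1 <;> simp only [n, Matrix.cons_val]
    · zify [hq1, hμ1, hμ]
      ring
    · zify [hq1, show m ≤ q₂ by lia, show m ≤ q₂ + 1 by lia]
      ring
    · ring
    · zify [hq1]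
      ring
  refine le_antisymm (ker_aeval_X_pow_le n J fun u v huv => ?_) hle
  have hmon : ∀ u : Fin 4 →₀ ℕ, Ideal.Quotient.mk J (MvPolynomial.monomial u 1) =
      Ideal.Quotient.mk J (MvPolynomial.X 0) ^ u 0 * Ideal.Quotient.mk J (MvPolynomial.X 1) ^ u 1 *
        Ideal.Quotient.mk J (MvPolynomial.X 2) ^ u 2 *
        Ideal.Quotient.mk J (MvPolynomial.X 3) ^ u 3 := by
    intro u
    rw [MvPolynomial.monomial_eq, Finsupp.prod_fintype _ _ (by simp), Fin.prod_univ_four]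
    simp
  have hweight : ∀ {a b c e a' b' c' e' : ℕ},
      Ideal.Quotient.mk J (MvPolynomial.X 0) ^ a * Ideal.Quotient.mk J (MvPolynomial.X 1) ^ b *
        Ideal.Quotient.mk J (MvPolynomial.X 2) ^ c * Ideal.Quotient.mk J (MvPolynomial.X 3) ^ e =
      Ideal.Quotient.mk J (MvPolynomial.X 0) ^ a' * Ideal.Quotient.mk J (MvPolynomial.X 1) ^ b' *
        Ideal.Quotient.mk J (MvPolynomial.X 2) ^ c' * Ideal.Quotient.mk J (MvPolynomial.X 3) ^ e' →
      a * n 0 + b * n 1 + c * n 2 + e * n 3 = a' * n 0 + b' * n 1 + c' * n 2 + e' * n 3 := by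
    intro a b c e a' b' c' e' heq
    simp only [← map_pow, ← map_mul] at heq
    have hker := hle (Ideal.Quotient.eq.mp heq)
    simp only [RingHom.mem_ker, AlgHom.toRingHom_eq_coe, RingHom.coe_coe,
        map_sub, map_mul, map_pow, MvPolynomial.aeval_X, sub_eq_zero, ← pow_mul, ← pow_add] at hker
    simpa [mul_comm] using congrArg Polynomial.natDegree hker
  have hred := exists_isBresinskyStandard hq
    (x := Ideal.Quotient.mk J (MvPolynomial.X 0)) (y := Ideal.Quotient.mk J (MvPolynomial.X 1))
    (z := Ideal.Quotient.mk J (MvPolynomial.X 2)) (w := Ideal.Quotient.mk J (MvPolynomial.X 3))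
    (fun μ h1 h2 => by
      simp only [← map_pow, ← map_mul]
      exact Ideal.Quotient.eq.mpr (Ideal.subset_span (.inl (.inl ⟨μ, h1, h2, rfl⟩))))
    (fun m h1 h2 => by
      simp only [← map_pow, ← map_mul]
      exact Ideal.Quotient.eq.mpr (Ideal.subset_span (.inl (.inr ⟨m, h1, h2, rfl⟩))))
    (by
      simp only [← map_pow]
      exact Ideal.Quotient.eq.mpr (Ideal.subset_span (.inr (.inl rfl))))
    (by
      simp only [← map_mul]
      exact Ideal.Quotient.eq.mpr (Ideal.subset_span (.inr (.inr rfl))))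
  obtain ⟨a, b, c, e, hstd, hu⟩ := hred (u 0) (u 1) (u 2) (u 3)
  obtain ⟨a', b', c', e', hstd', hv⟩ := hred (v 0) (v 1) (v 2) (v 3)
  rw [Finsupp.weight_apply, Finsupp.weight_apply, Finsupp.sum_fintype _ _ (by simp),
    Finsupp.sum_fintype _ _ (by simp), Fin.sum_univ_four, Fin.sum_univ_four] at huv
  simp only [smul_eq_mul] at huv
  obtain ⟨rfl, rfl, rfl, rfl⟩ := hstd.eq_of_weight_eq hq heven hstd'
    ((hweight hu).symm.trans (huv.trans (hweight hv)))
  rw [hmon, hmon, hu, hv]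
end

section
/- For the Bresinsky sequence n₁ = q₁q₂, n₂ = q₁d₁, n₃ = q₁q₂ + d₁, n₄ = q₂d₁, the minimal number of generators of the defining ideal 𝔭(n₁,n₂,n₃,n₄) equals 2q₂: there is a generating set of cardinality 2q₂, and every generating set of 𝔭(n₁,n₂,n₃,n₄) has at least 2q₂ elements. -/
open Polynomial

namespace Bresinsky

section Binomials

variable {k σ ι : Type*} [Field k]

/-- The binomial `x ^ u - x ^ v`. -/
noncomputable def binomial (k : Type*) [Field k] {σ : Type*} (u v : σ →₀ ℕ) : MvPolynomial σ k :=
  MvPolynomial.monomial u 1 - MvPolynomial.monomial v 1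

/-- The ideal generated by the binomials `x ^ u i - x ^ v i`. -/
noncomputable def binomialIdeal (k : Type*) [Field k] {σ ι : Type*} (u v : ι → σ →₀ ℕ) :
    Ideal (MvPolynomial σ k) :=
  Ideal.span (Set.range fun i => binomial k (u i) (v i))

lemma coeff_binomial [DecidableEq ι] {u v : ι → σ →₀ ℕ} (hu : ∀ i j, u i ≤ u j → i = j)
    (hv : ∀ i j, ¬ v i ≤ u j) (i j : ι) :
    (binomial k (u i) (v i)).coeff (u j) = if i = j then 1 else 0 := by
  classical
  have hvu : v i ≠ u j := fun h => hv i j h.le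
  have huu : u i = u j ↔ i = j := ⟨fun h => hu i j h.le, fun h => h ▸ rfl⟩
  simp [binomial, MvPolynomial.coeff_monomial, hvu, huu]

lemma binomial_injective {u v : ι → σ →₀ ℕ} (hu : ∀ i j, u i ≤ u j → i = j)
    (hv : ∀ i j, ¬ v i ≤ u j) : Function.Injective fun i => binomial k (u i) (v i) := by
  classical
  intro i j h
  have h' := congrArg (MvPolynomial.coeff (u j)) h
  simp only [coeff_binomial hu hv] at h'
  by_contra hij
  simp [hij] at h'

/-- Coefficients strictly below a leading exponent vanish on the ideal. -/
lemma coeff_eq_zero_of_mem {u v : ι → σ →₀ ℕ} (hu : ∀ i j, u i ≤ u j → i = j)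
    (hv : ∀ i j, ¬ v i ≤ u j) {f : MvPolynomial σ k} (hf : f ∈ binomialIdeal k u v)
    {w : σ →₀ ℕ} {j : ι} (hw : w < u j) : f.coeff w = 0 := by
  classical
  refine Submodule.span_induction (p := fun f _ => ∀ w < u j, MvPolynomial.coeff w f = 0)
    ?_ ?_ ?_ ?_ hf w hw
  · rintro _ ⟨i, rfl⟩ w hw
    have h1 : u i ≠ w := by
      rintro rfl
      exact hw.ne (congrArg u (hu i j hw.le))
    have h2 : v i ≠ w := by
      rintro rfl
      exact hv i j hw.le
    simp [binomial, MvPolynomial.coeff_monomial, h1, h2]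
  · simp
  · intro f g _ _ hf hg w hw
    simp [hf w hw, hg w hw]
  · intro h f _ hf w hw
    rw [smul_eq_mul, MvPolynomial.coeff_mul]
    refine Finset.sum_eq_zero fun x hx => ?_
    have hx' : x.2 ≤ w := by
      rw [← Finset.HasAntidiagonal.mem_antidiagonal.mp hx]
      exact le_add_self
    rw [hf _ (hx'.trans_lt hw), mul_zero]

lemma coeff_mul_of_mem {u v : ι → σ →₀ ℕ} (hu : ∀ i j, u i ≤ u j → i = j)
    (hv : ∀ i j, ¬ v i ≤ u j) {f : MvPolynomial σ k} (hf : f ∈ binomialIdeal k u v)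
    (h : MvPolynomial σ k) (j : ι) : (h * f).coeff (u j) = h.coeff 0 * f.coeff (u j) := by
  classical
  rw [MvPolynomial.coeff_mul, Finset.sum_eq_single (0, u j)]
  · intro x hx hne
    have hx' := Finset.HasAntidiagonal.mem_antidiagonal.mp hx
    have hlt : x.2 < u j := by
      refine lt_of_le_of_ne (hx' ▸ le_add_self) fun heq => hne ?_
      have h0 : x.1 = 0 := by simpa [heq] using hx'
      exact Prod.ext h0 heq
    rw [coeff_eq_zero_of_mem hu hv hf hlt, mul_zero]
  · simp

/-- If the leading exponents `u i` are pairwise incomparable and bounded below by no `v i`, then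
no generating set of the ideal has fewer elements than the family of binomials. -/
lemma card_le_of_span_eq [Fintype ι] {u v : ι → σ →₀ ℕ} (hu : ∀ i j, u i ≤ u j → i = j)
    (hv : ∀ i j, ¬ v i ≤ u j) (s : Finset (MvPolynomial σ k))
    (hs : Ideal.span (s : Set (MvPolynomial σ k)) = binomialIdeal k u v) :
    Fintype.card ι ≤ s.card := by
  classical
  let L : MvPolynomial σ k →ₗ[k] ι → k := LinearMap.pi fun i => MvPolynomial.lcoeff k (u i)
  have hL : ∀ f i, L f i = f.coeff (u i) := fun f i => rfl
  have key : ∀ f ∈ Ideal.span (s : Set (MvPolynomial σ k)),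
      L f ∈ Submodule.span k (s.image L : Set (ι → k)) := by
    intro f hf
    refine Submodule.span_induction
      (p := fun f _ => L f ∈ Submodule.span k (s.image L : Set (ι → k))) ?_ ?_ ?_ ?_ hf
    · intro f hf
      exact Submodule.subset_span (by simpa using ⟨f, hf, rfl⟩)
    · simp
    · intro f g _ _ hf hg
      rw [map_add]
      exact add_mem hf hg
    · intro h f hf' hf
      have : L (h • f) = h.coeff 0 • L f := by
        ext i
        simp only [Pi.smul_apply, smul_eq_mul, hL]
        exact coeff_mul_of_mem hu hv (hs ▸ hf') h i
      rw [this]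
      exact Submodule.smul_mem _ _ hf
  have htop : Submodule.span k (s.image L : Set (ι → k)) = ⊤ := by
    rw [eq_top_iff, ← (Pi.basisFun k ι).span_eq, Submodule.span_le]
    rintro _ ⟨i, rfl⟩
    have hi : L (binomial k (u i) (v i)) = Pi.basisFun k ι i := by
      ext j
      rw [hL, coeff_binomial hu hv, Pi.basisFun_apply, Pi.single_apply]
      simp only [eq_comm]
    rw [← hi]
    exact key _ (hs ▸ Ideal.subset_span ⟨i, rfl⟩)
  calc Fintype.card ι = Module.finrank k (ι → k) := by simp
    _ = Module.finrank k (Submodule.span k (s.image L : Set (ι → k))) := by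
      rw [htop, finrank_top]
    _ ≤ (s.image L).card := finrank_span_finset_le_card _
    _ ≤ s.card := Finset.card_image_le

/-- The toric ideal of the weights `n`. -/
noncomputable def toricIdeal (k : Type*) [Field k] {σ : Type*} (n : σ → ℕ) :
    Ideal (MvPolynomial σ k) :=
  RingHom.ker (MvPolynomial.aeval (R := k) fun i => (X : k[X]) ^ n i).toRingHom

lemma aeval_monomial_X_pow (n : σ → ℕ) (w : σ →₀ ℕ) (c : k) :
    MvPolynomial.aeval (R := k) (fun i => (X : k[X]) ^ n i) (MvPolynomial.monomial w c) =
      Polynomial.monomial (Finsupp.weight n w) c := by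
  rw [MvPolynomial.aeval_monomial, ← Polynomial.C_mul_X_pow_eq_monomial]
  congr 1
  simp only [Finsupp.weight_apply, Finsupp.prod, Finsupp.sum, ← pow_mul, Finset.prod_pow_eq_pow_sum,
    smul_eq_mul, mul_comm]

lemma binomialIdeal_le_toricIdeal {n : σ → ℕ} {u v : ι → σ →₀ ℕ}
    (huv : ∀ i, Finsupp.weight n (u i) = Finsupp.weight n (v i)) :
    binomialIdeal k u v ≤ toricIdeal k n := by
  refine Ideal.span_le.mpr ?_
  rintro _ ⟨i, rfl⟩
  change MvPolynomial.aeval (R := k) _ _ = 0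
  simp only [binomial]
  rw [map_sub, aeval_monomial_X_pow, aeval_monomial_X_pow, huv, sub_self]

lemma exists_normal_form {n : σ → ℕ} {u v : ι → σ →₀ ℕ}
    (huv : ∀ i, Finsupp.weight n (u i) = Finsupp.weight n (v i)) (N : (σ →₀ ℕ) → Prop)
    (μ : (σ →₀ ℕ) →+ ℕ) (hμ : ∀ i, μ (v i) < μ (u i))
    (hN : ∀ w, ¬ N w → ∃ i, u i ≤ w) (w : σ →₀ ℕ) :
    ∃ w', N w' ∧ Finsupp.weight n w' = Finsupp.weight n w ∧
      binomial k w w' ∈ binomialIdeal k u v := by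
  induction hm : μ w using Nat.strong_induction_on generalizing w with
  | _ m ih =>
    by_cases hw : N w
    · exact ⟨w, hw, rfl, by simp [binomial]⟩
    obtain ⟨i, hi⟩ := hN w hw
    obtain ⟨z, rfl⟩ := exists_add_of_le hi
    obtain ⟨w', h1, h2, h3⟩ := ih (μ (v i + z)) (by
      rw [← hm, map_add, map_add]
      exact Nat.add_lt_add_right (hμ i) _) (v i + z) rfl
    refine ⟨w', h1, by rw [h2, map_add, map_add, huv], ?_⟩
    have hstep : binomial k (u i + z) (v i + z) ∈ binomialIdeal k u v := by
      have := Ideal.mul_mem_left (binomialIdeal k u v) (MvPolynomial.monomial z 1)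
        (Ideal.subset_span ⟨i, rfl⟩)
      simpa [binomial, mul_sub, MvPolynomial.monomial_mul, add_comm] using this
    simpa [binomial] using add_mem hstep h3

/-- A rewriting criterion: the binomials generate the toric ideal if they are homogeneous, every
exponent outside `N` is divisible by some `u i`, the rewriting `u i → v i` terminates, and the
weights of exponents in `N` are distinct. -/
lemma toricIdeal_eq_binomialIdeal {n : σ → ℕ} {u v : ι → σ →₀ ℕ}
    (huv : ∀ i, Finsupp.weight n (u i) = Finsupp.weight n (v i)) (N : (σ →₀ ℕ) → Prop)
    (μ : (σ →₀ ℕ) →+ ℕ) (hμ : ∀ i, μ (v i) < μ (u i))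
    (hN : ∀ w, ¬ N w → ∃ i, u i ≤ w)
    (hinj : ∀ w w', N w → N w' → Finsupp.weight n w = Finsupp.weight n w' → w = w') :
    binomialIdeal k u v = toricIdeal k n := by
  classical
  refine le_antisymm (binomialIdeal_le_toricIdeal huv) fun p hp => ?_
  have hcongr : ∀ w w', Finsupp.weight n w = Finsupp.weight n w' →
      binomial k w w' ∈ binomialIdeal k u v := by
    intro w w' h
    obtain ⟨z, hz, hz1, hz2⟩ := exists_normal_form (k := k) huv N μ hμ hN w
    obtain ⟨z', hz', hz1', hz2'⟩ := exists_normal_form (k := k) huv N μ hμ hN w'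
    obtain rfl : z = z' := hinj _ _ hz hz' (by rw [hz1, hz1', h])
    simpa [binomial] using sub_mem hz2 hz2'
  let Q := Ideal.Quotient.mkₐ k (binomialIdeal k u v)
  let S : k[X] →ₗ[k] (MvPolynomial σ k ⧸ binomialIdeal k u v) :=
    (Polynomial.basisMonomials k).constr k fun m =>
      if h : ∃ w, Finsupp.weight n w = m then Q (MvPolynomial.monomial h.choose 1) else 0
  have hS : S ∘ₗ (MvPolynomial.aeval (R := k) fun i => (X : k[X]) ^ n i).toLinearMap =
      Q.toLinearMap := by
    refine (MvPolynomial.basisMonomials σ k).ext fun w => ?_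
    have hex : ∃ w', Finsupp.weight n w' = Finsupp.weight n w := ⟨w, rfl⟩
    have h1 : S (Polynomial.monomial (Finsupp.weight n w) 1) =
        Q (MvPolynomial.monomial hex.choose 1) := by
      have := (Polynomial.basisMonomials k).constr_basis k (fun m =>
        if h : ∃ w, Finsupp.weight n w = m then Q (MvPolynomial.monomial h.choose 1) else 0)
        (Finsupp.weight n w)
      rw [Polynomial.coe_basisMonomials] at this
      exact this.trans (dif_pos hex)
    simp only [MvPolynomial.coe_basisMonomials, LinearMap.comp_apply, AlgHom.toLinearMap_apply,
      aeval_monomial_X_pow, h1]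
    exact Ideal.Quotient.eq.mpr (hcongr _ _ hex.choose_spec)
  have hp' : MvPolynomial.aeval (R := k) (fun i => (X : k[X]) ^ n i) p = 0 := hp
  have hQ : Q p = 0 := by
    have := LinearMap.congr_fun hS p
    rw [LinearMap.comp_apply, AlgHom.toLinearMap_apply, hp', map_zero] at this
    exact this.symm
  exact Ideal.Quotient.eq_zero_iff_mem.mp hQ

end Binomials

/-- The exponent vector `(a, b, c, e)`. -/
noncomputable def expVec (a b c e : ℕ) : Fin 4 →₀ ℕ := Finsupp.equivFunOnFinite.symm ![a, b, c, e]

lemma expVec_le_iff (a b c e : ℕ) (w : Fin 4 →₀ ℕ) :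
    expVec a b c e ≤ w ↔ a ≤ w 0 ∧ b ≤ w 1 ∧ c ≤ w 2 ∧ e ≤ w 3 := by
  rw [Finsupp.le_def, Fin.forall_fin_succ, Fin.forall_fin_succ, Fin.forall_fin_two]
  simp [expVec]

lemma weight_fin_four (n : Fin 4 → ℕ) (w : Fin 4 →₀ ℕ) :
    Finsupp.weight n w = w 0 * n 0 + w 1 * n 1 + w 2 * n 2 + w 3 * n 3 := by
  rw [Finsupp.weight_apply, Finsupp.sum_fintype _ _ (by simp), Fin.sum_univ_four]
  simp

@[simp] lemma expVec_zero (a b c e : ℕ) : expVec a b c e 0 = a := rfl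
@[simp] lemma expVec_one (a b c e : ℕ) : expVec a b c e 1 = b := rfl
@[simp] lemma expVec_two (a b c e : ℕ) : expVec a b c e 2 = c := rfl
@[simp] lemma expVec_three (a b c e : ℕ) : expVec a b c e 3 = e := rfl

/-- The index type of the generators. -/
abbrev Index (q : ℕ) : Type := Fin q ⊕ Fin (q - 1) ⊕ Unit

/-- Leading exponents `x₁^(q-1-j) x₃^j`, `x₂^(q-j) x₃^j` and `x₁ x₂`. -/
noncomputable def lead (q : ℕ) : Index q → Fin 4 →₀ ℕ
  | .inl j => expVec (q - 1 - j) 0 j 0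
  | .inr (.inl j) => expVec 0 (q - j) j 0
  | .inr (.inr _) => expVec 1 1 0 0

/-- Trailing exponents `x₂^j x₄^(q+1-j)`, `x₁^j x₄^(q+1-j)` and `x₃ x₄`. -/
noncomputable def trail (q : ℕ) : Index q → Fin 4 →₀ ℕ
  | .inl j => expVec 0 j 0 (q + 1 - j)
  | .inr (.inl j) => expVec j 0 0 (q + 1 - j)
  | .inr (.inr _) => expVec 0 0 1 1

/-- The weights of the Bresinsky curve. -/
def curveWeight (q : ℕ) : Fin 4 → ℕ :=
  ![(q + 1) * q, (q + 1) * (q - 1), (q + 1) * q + (q - 1), q * (q - 1)]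

/-- Exponents divisible by no leading exponent. -/
def IsStandard (q : ℕ) (w : Fin 4 →₀ ℕ) : Prop :=
  (w 0 = 0 ∨ w 1 = 0) ∧ w 0 + w 2 ≤ q - 2 ∧ w 1 + w 2 ≤ q - 1

lemma lead_antichain (q : ℕ) (hq : 4 ≤ q) (i j : Index q) (h : lead q i ≤ lead q j) : i = j := by
  rcases i with i | i | i <;> rcases j with j | j | j <;>
    simp only [lead, expVec_le_iff, expVec_zero, expVec_one, expVec_two, expVec_three] at h <;>
    simp only [Sum.inl.injEq, Sum.inr.injEq, reduceCtorEq, Fin.ext_iff] <;> omega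

lemma not_trail_le_lead (q : ℕ) (i j : Index q) : ¬ trail q i ≤ lead q j := by
  rcases i with i | i | i <;> rcases j with j | j | j <;>
    simp only [lead, trail, expVec_le_iff, expVec_zero, expVec_one, expVec_two, expVec_three] <;>
    omega

lemma weight_lead_eq_weight_trail (q : ℕ) (hq : 4 ≤ q) (i : Index q) :
    Finsupp.weight (curveWeight q) (lead q i) = Finsupp.weight (curveWeight q) (trail q i) := by
  obtain ⟨r, rfl⟩ := Nat.exists_eq_add_of_le' (show 1 ≤ q by omega)
  rcases i with ⟨i, hi⟩ | ⟨i, hi⟩ | i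
  · obtain ⟨m, hm⟩ := Nat.exists_eq_add_of_le (show i ≤ r by omega)
    have h1 : r + 1 + 1 - i = m + 2 := by omega
    have h2 : r - i = m := by omega
    simp [weight_fin_four, lead, trail, curveWeight, h1, h2]
    subst hm
    ring
  · obtain ⟨m, hm⟩ := Nat.exists_eq_add_of_le (show i ≤ r by omega)
    have h1 : r + 1 + 1 - i = m + 2 := by omega
    have h2 : r + 1 - i = m + 1 := by omega
    simp [weight_fin_four, lead, trail, curveWeight, h1, h2]
    subst hm
    ring
  · simp [weight_fin_four, lead, trail, curveWeight]
    ring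

lemma exists_lead_le_of_not_isStandard (q : ℕ) (hq : 4 ≤ q) (w : Fin 4 →₀ ℕ)
    (hw : ¬ IsStandard q w) : ∃ i, lead q i ≤ w := by
  unfold IsStandard at hw
  by_cases h01 : 1 ≤ w 0 ∧ 1 ≤ w 1
  · exact ⟨.inr (.inr ()), (expVec_le_iff _ _ _ _ _).mpr ⟨h01.1, h01.2, by omega, by omega⟩⟩
  by_cases h02 : q - 1 ≤ w 0 + w 2
  · refine ⟨.inl ⟨min (w 2) (q - 1), by omega⟩, (expVec_le_iff _ _ _ _ _).mpr ?_⟩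
    dsimp only
    omega
  · refine ⟨.inr (.inl ⟨w 2, by omega⟩), (expVec_le_iff _ _ _ _ _).mpr ?_⟩
    dsimp only
    omega

/-- The weight with the contribution of `x₄` dropped, which decreases under rewriting. -/
noncomputable def reducedWeight (q : ℕ) : (Fin 4 →₀ ℕ) →+ ℕ :=
  Finsupp.weight ![(q + 1) * q, (q + 1) * (q - 1), (q + 1) * q + (q - 1), 0]

lemma weight_eq_reducedWeight_add (q : ℕ) (w : Fin 4 →₀ ℕ) :
    Finsupp.weight (curveWeight q) w = reducedWeight q w + w 3 * (q * (q - 1)) := by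
  simp [reducedWeight, weight_fin_four, curveWeight]

lemma reducedWeight_trail_lt (q : ℕ) (hq : 4 ≤ q) (i : Index q) :
    reducedWeight q (trail q i) < reducedWeight q (lead q i) := by
  have h := weight_lead_eq_weight_trail q hq i
  rw [weight_eq_reducedWeight_add, weight_eq_reducedWeight_add] at h
  have hl : lead q i 3 = 0 := by rcases i with i | i | i <;> rfl
  have ht : 0 < trail q i 3 := by rcases i with i | i | i <;> (simp [trail]; try omega)
  have hpos : 0 < trail q i 3 * (q * (q - 1)) :=
    Nat.mul_pos ht (Nat.mul_pos (by omega) (by omega))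
  rw [hl] at h
  omega

lemma eq_of_weight_eq (q : ℕ) (hq : 4 ≤ q) (heven : Even q) (w w' : Fin 4 →₀ ℕ)
    (hw : IsStandard q w) (hw' : IsStandard q w')
    (h : Finsupp.weight (curveWeight q) w = Finsupp.weight (curveWeight q) w') : w = w' := by
  obtain ⟨h01, h02, h12⟩ := hw
  obtain ⟨h01', h02', h12'⟩ := hw'
  have hn : 0 < q * (q - 1) := Nat.mul_pos (by omega) (by omega)
  have hpos : ((q - 1 : ℕ) : ℤ) = q - 1 := by omega
  have hZ : (w 0 : ℤ) * ((q + 1) * q) + w 1 * ((q + 1) * (q - 1)) +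
      w 2 * ((q + 1) * q + (q - 1)) + w 3 * (q * (q - 1)) =
      (w' 0 : ℤ) * ((q + 1) * q) + w' 1 * ((q + 1) * (q - 1)) +
      w' 2 * ((q + 1) * q + (q - 1)) + w' 3 * (q * (q - 1)) := by
    simp only [weight_fin_four, curveWeight] at h
    simp only [← hpos]
    exact_mod_cast h
  have hmod : (q : ℤ) ∣ ((w 1 + w 2 : ℕ) : ℤ) - (w' 1 + w' 2 : ℕ) := by
    refine ⟨(w 0 - w' 0) * (q + 1) + (w 1 - w' 1) * q + (w 2 - w' 2) * (q + 2) +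
      (w 3 - w' 3) * (q - 1), ?_⟩
    push_cast
    linear_combination -hZ
  have hmod' : ((q - 1 : ℕ) : ℤ) ∣ 2 * (((w 0 + w 2 : ℕ) : ℤ) - (w' 0 + w' 2 : ℕ)) := by
    refine ⟨-((w 0 - w' 0) * (q + 2) + (w 1 - w' 1) * (q + 1) + (w 2 - w' 2) * (q + 3) +
      (w 3 - w' 3) * q), ?_⟩
    push_cast [hpos]
    linear_combination hZ
  have hcop : IsCoprime ((q - 1 : ℕ) : ℤ) 2 := by
    obtain ⟨r, hr⟩ := heven
    refine ⟨-1, r, ?_⟩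
    omega
  have hd := hcop.dvd_of_dvd_mul_left hmod'
  have e1 : ((w 1 + w 2 : ℕ) : ℤ) - (w' 1 + w' 2 : ℕ) = 0 :=
    Int.eq_zero_of_abs_lt_dvd hmod (by rw [abs_lt]; omega)
  have e2 : ((w 0 + w 2 : ℕ) : ℤ) - (w' 0 + w' 2 : ℕ) = 0 :=
    Int.eq_zero_of_abs_lt_dvd hd (by rw [abs_lt]; omega)
  have f0 : w 0 = w' 0 := by omega
  have f1 : w 1 = w' 1 := by omega
  have f2 : w 2 = w' 2 := by omega
  have f3 : w 3 = w' 3 := by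
    rw [weight_fin_four, weight_fin_four, f0, f1, f2] at h
    exact Nat.eq_of_mul_eq_mul_right hn (Nat.add_left_cancel h)
  ext i
  fin_cases i <;> assumption

lemma binomialIdeal_lead_trail (k : Type*) [Field k] (q : ℕ) (hq : 4 ≤ q) (heven : Even q) :
    binomialIdeal k (lead q) (trail q) = toricIdeal k (curveWeight q) :=
  toricIdeal_eq_binomialIdeal (weight_lead_eq_weight_trail q hq) (IsStandard q) (reducedWeight q)
    (reducedWeight_trail_lt q hq) (exists_lead_le_of_not_isStandard q hq)
    (eq_of_weight_eq q hq heven)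

lemma card_index (q : ℕ) (hq : 4 ≤ q) : Fintype.card (Index q) = 2 * q := by
  simp only [Index, Fintype.card_sum, Fintype.card_fin, Fintype.card_unit]
  omega

end Bresinsky

/-- For the Bresinsky sequence `n₁ = q₁q₂`, `n₂ = q₁d₁`,
`n₃ = q₁q₂ + d₁`, `n₄ = q₂d₁` (with `q₂ ≥ 4` even, `q₁ = q₂ + 1`, `d₁ = q₂ − 1`),
the minimal number of generators of the defining ideal `𝔭(n₁,n₂,n₃,n₄)` equals
`2q₂`: there is a generating set of cardinality `2q₂`, and every finite generating
set has at least `2q₂` elements. -/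
theorem bresinsky_first_betti_number (k : Type*) [Field k] (q₂ : ℕ) (hq : 4 ≤ q₂)
    (heven : Even q₂) :
    letI q₁ : ℕ := q₂ + 1
    letI d₁ : ℕ := q₂ - 1
    letI n : Fin 4 → ℕ := ![q₁ * q₂, q₁ * d₁, q₁ * q₂ + d₁, q₂ * d₁]
    letI 𝔭 : Ideal (MvPolynomial (Fin 4) k) :=
      RingHom.ker (MvPolynomial.aeval (R := k) fun i => (X : k[X]) ^ n i).toRingHom
    (∃ s : Finset (MvPolynomial (Fin 4) k), s.card = 2 * q₂ ∧
        Ideal.span (s : Set (MvPolynomial (Fin 4) k)) = 𝔭) ∧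
    (∀ s : Finset (MvPolynomial (Fin 4) k),
        Ideal.span (s : Set (MvPolynomial (Fin 4) k)) = 𝔭 → 2 * q₂ ≤ s.card) := by
  classical
  have h𝔭 := Bresinsky.binomialIdeal_lead_trail k q₂ hq heven
  rw [Bresinsky.toricIdeal, Bresinsky.curveWeight] at h𝔭
  have hu := Bresinsky.lead_antichain q₂ hq
  have hv := Bresinsky.not_trail_le_lead q₂
  rw [← Bresinsky.card_index q₂ hq, ← h𝔭]
  refine ⟨⟨Finset.univ.image fun i =>
    Bresinsky.binomial k (Bresinsky.lead q₂ i) (Bresinsky.trail q₂ i), ?_, ?_⟩,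
    fun s hs => Bresinsky.card_le_of_span_eq hu hv s hs⟩
  · rw [Finset.card_image_of_injective _ (Bresinsky.binomial_injective hu hv), Finset.card_univ]
  · rw [Finset.coe_image, Finset.coe_univ, Set.image_univ, Bresinsky.binomialIdeal]
end

section
/- (Bresinsky; β₁(r) = ∞ for r ≥ 4) For every integer p ≥ 3 and every positive integer N, there exist positive integers n₀ < n₁ < ... < n_p with gcd(n₀,...,n_p) = 1 that minimally generate the numerical semigroup Γ(n₀,...,n_p), such that the defining ideal 𝔭(n₀,...,n_p) ⊆ k[x₀,...,x_p] cannot be generated by N elements. -/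
open Polynomial

/-- An exponent vector `u` is isolated with respect to the weights `n` if its weight has another
factorization, and every other factorization of that weight has support disjoint from `u`. -/
def IsIsolatedFactorization {σ : Type*} [Fintype σ] (n u : σ → ℕ) : Prop :=
  (∃ v, v ≠ u ∧ ∑ i, v i * n i = ∑ i, u i * n i) ∧
    ∀ v, ∑ i, v i * n i = ∑ i, u i * n i → v ≠ u → ∀ i, u i = 0 ∨ v i = 0

section LowerBound

variable {k : Type*} [Field k] {σ : Type*} [Fintype σ]

/-- The kernel of the monomial map `xᵢ ↦ t ^ nᵢ`. -/
noncomputable abbrev monomialCurveIdeal (k : Type*) [Field k] {σ : Type*} (n : σ → ℕ) :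
    Ideal (MvPolynomial σ k) :=
  RingHom.ker (MvPolynomial.aeval (R := k) fun i => (X : k[X]) ^ n i).toRingHom

theorem aeval_X_pow_monomial (n : σ → ℕ) (u : σ →₀ ℕ) (c : k) :
    MvPolynomial.aeval (fun i => (X : k[X]) ^ n i) (MvPolynomial.monomial u c) =
      Polynomial.monomial (∑ i, u i * n i) c := by
  rw [MvPolynomial.aeval_monomial, Finsupp.prod_fintype _ _ (by simp),
    ← Polynomial.C_mul_X_pow_eq_monomial, ← Finset.prod_pow_eq_pow_sum]
  simp [← pow_mul, mul_comm, Polynomial.algebraMap_eq]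

theorem monomial_sub_monomial_mem_monomialCurveIdeal (n : σ → ℕ) {u v : σ →₀ ℕ}
    (h : ∑ i, v i * n i = ∑ i, u i * n i) :
    MvPolynomial.monomial u 1 - MvPolynomial.monomial v 1 ∈ monomialCurveIdeal k n := by
  change MvPolynomial.aeval (fun i => (X : k[X]) ^ n i) _ = 0
  rw [map_sub, aeval_X_pow_monomial, aeval_X_pow_monomial, h, sub_self]

theorem coeff_eq_zero_of_unique_factorization {n : σ → ℕ} {u : σ →₀ ℕ}
    (hu : ∀ v : σ →₀ ℕ, ∑ i, v i * n i = ∑ i, u i * n i → v = u)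
    {g : MvPolynomial σ k} (hg : g ∈ monomialCurveIdeal k n) : g.coeff u = 0 := by
  replace hg : MvPolynomial.aeval (fun i => (X : k[X]) ^ n i) g = 0 := hg
  rw [g.as_sum, map_sum] at hg
  simp only [aeval_X_pow_monomial] at hg
  have h := congrArg (fun f : k[X] => f.coeff (∑ i, u i * n i)) hg
  simp only [Polynomial.finsetSum_coeff, Polynomial.coeff_monomial, Polynomial.coeff_zero] at h
  rw [Finset.sum_eq_single u] at h
  · simpa using h
  · intro v _ hv
    exact if_neg fun hw => hv (hu v hw)
  · intro hu
    simpa using hu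

theorem coeff_mul_of_isIsolatedFactorization {n : σ → ℕ} {u : σ →₀ ℕ}
    (hu : IsIsolatedFactorization n u) (g : MvPolynomial σ k) {f : MvPolynomial σ k}
    (hf : f ∈ monomialCurveIdeal k n) : (g * f).coeff u = g.coeff 0 * f.coeff u := by
  classical
  rw [MvPolynomial.coeff_mul, Finset.sum_eq_single (0, u)]
  · rintro ⟨x, y⟩ hxy hne
    rw [Finset.HasAntidiagonal.mem_antidiagonal] at hxy
    have hx : x ≠ 0 := by
      rintro rfl
      exact hne (by simpa using hxy)
    obtain ⟨i, hi⟩ := Finsupp.ne_iff.mp hx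
    have hy : f.coeff y = 0 := by
      refine coeff_eq_zero_of_unique_factorization (fun v hv => ?_) hf
      by_contra hvy
      have := hu.2 (x + v : σ →₀ ℕ) (by simp [← hxy, add_mul, Finset.sum_add_distrib, hv])
        (fun h => hvy (add_left_cancel ((DFunLike.coe_injective h).trans hxy.symm))) i
      simp only [← hxy, Finsupp.add_apply, Finsupp.coe_zero, Pi.zero_apply] at this hi
      omega
    simp [hy]
  · simp

/-- Isolated factorizations of distinct weights bound the number of generators from below. -/
theorem card_le_card_of_span_eq_monomialCurveIdeal {ι : Type*} [Fintype ι] {n : σ → ℕ}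
    (u : ι → σ →₀ ℕ) (hinj : Function.Injective fun j => ∑ i, u j i * n i)
    (hu : ∀ j, IsIsolatedFactorization n (u j)) (s : Finset (MvPolynomial σ k))
    (hs : Ideal.span (s : Set (MvPolynomial σ k)) = monomialCurveIdeal k n) :
    Fintype.card ι ≤ s.card := by
  classical
  let Φ : MvPolynomial σ k →ₗ[k] ι → k := LinearMap.pi fun j => MvPolynomial.lcoeff k (u j)
  have hΦ : ∀ f j, Φ f j = f.coeff (u j) := fun _ _ => rfl
  have hspan : ∀ f ∈ monomialCurveIdeal k n,
      Φ f ∈ Submodule.span k ((s.image Φ : Finset (ι → k)) : Set (ι → k)) := by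
    intro f hf
    rw [← hs] at hf
    induction hf using Submodule.span_induction with
    | mem f hf => exact Submodule.subset_span (Finset.mem_image_of_mem Φ hf)
    | zero => simp
    | add f g _ _ hf hg =>
      rw [map_add]
      exact add_mem hf hg
    | smul g f hfs hf =>
      have : Φ (g • f) = g.coeff 0 • Φ f := by
        ext j
        exact coeff_mul_of_isIsolatedFactorization (hu j) g (hs ▸ hfs)
      rw [this]
      exact Submodule.smul_mem _ _ hf
  have htop : Submodule.span k ((s.image Φ : Finset (ι → k)) : Set (ι → k)) = ⊤ := by
    rw [eq_top_iff, ← (Pi.basisFun k ι).span_eq, Submodule.span_le]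
    rintro _ ⟨j, rfl⟩
    obtain ⟨v, hv, hvw⟩ := (hu j).1
    obtain ⟨v, rfl⟩ := Finsupp.equivFunOnFinite.surjective v
    suffices h : Pi.basisFun k ι j =
        Φ (MvPolynomial.monomial (u j) 1 - MvPolynomial.monomial v 1) by
      rw [h]
      exact hspan _ (monomial_sub_monomial_mem_monomialCurveIdeal n hvw)
    ext l
    rw [hΦ, MvPolynomial.coeff_sub, MvPolynomial.coeff_monomial, MvPolynomial.coeff_monomial,
      Pi.basisFun_apply]
    by_cases hl : l = j
    · subst hl
      have : v ≠ u l := fun h => hv (by rw [h]; rfl)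
      simp [this]
    · have h1 : u j ≠ u l := fun h => hl (hinj (by simp [h]))
      have h2 : v ≠ u l := by
        rintro rfl
        exact hl (hinj hvw)
      simp [hl, h1, h2]
  calc Fintype.card ι = Module.finrank k (ι → k) := by simp
    _ ≤ (s.image Φ).card := by
      rw [← finrank_top, ← htop]
      exact finrank_span_finset_le_card _
    _ ≤ s.card := Finset.card_image_le

end LowerBound

theorem exists_weights_of_mem_closure {σ : Type*} [Fintype σ] {n : σ → ℕ} {i : σ} {x : ℕ}
    (hx : x ∈ AddSubmonoid.closure {x : ℕ | ∃ j, j ≠ i ∧ x = n j}) :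
    ∃ c : σ → ℕ, c i = 0 ∧ ∑ j, c j * n j = x := by
  classical
  induction hx using AddSubmonoid.closure_induction with
  | mem x hx =>
    obtain ⟨j, hj, rfl⟩ := hx
    exact ⟨Pi.single j 1, by simp [hj.symm], by simp [Pi.single_apply]⟩
  | zero => exact ⟨0, by simp⟩
  | add x y _ _ hx hy =>
    obtain ⟨c, hc, rfl⟩ := hx
    obtain ⟨d, hd, rfl⟩ := hy
    exact ⟨c + d, by simp [hc, hd], by simp [add_mul, Finset.sum_add_distrib]⟩

/-- Increasing minimal generators of a numerical semigroup admitting `M` isolated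
factorizations of distinct weights. -/
structure HasIsolatedFactorizations {r : ℕ} (n : Fin r → ℕ) (M : ℕ) : Prop where
  pos : ∀ i, 0 < n i
  strictMono : StrictMono n
  eq_one_of_dvd : ∀ d : ℕ, (∀ i, d ∣ n i) → d = 1
  minimal : ∀ i (c : Fin r → ℕ), ∑ j, c j * n j = n i → c i ≠ 0
  exists_isolated : ∃ u : Fin M → Fin r → ℕ,
    Function.Injective (fun j => ∑ i, u j i * n i) ∧ ∀ j, IsIsolatedFactorization n (u j)

/-- The weights `q(q-1), q²-1, q(q+1), q²+2q-1`, written in terms of `m = q - 1`. -/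
def bresinskyWeights (m : ℕ) : Fin 4 → ℕ :=
  ![m * (m + 1), m * (m + 2), m * (m + 3) + 2, m * (m + 4) + 2]

theorem isIsolatedFactorization_bresinskyWeights {m j : ℕ} (hm : Odd m) (hj : j ≤ m) :
    IsIsolatedFactorization (bresinskyWeights m) ![0, 0, m - j, j] := by
  have hpos := hm.pos
  obtain ⟨l, rfl⟩ := Nat.exists_eq_add_of_le hj
  simp only [Nat.add_sub_cancel_left]
  refine ⟨⟨![l + 2, j, 0, 0], fun h => ?_, ?_⟩, fun v hv hne => ?_⟩
  · simpa using congrFun h 0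
  · simp [bresinskyWeights, Fin.sum_univ_four]
    ring
  simp only [bresinskyWeights, Fin.sum_univ_four, Matrix.cons_val] at hv
  generalize hmm : j + l = m at *
  have hv' : m * (v 0 * (m + 1) + v 1 * (m + 2) + (v 2 + v 3) * (m + 3) + v 3) +
      2 * (v 2 + v 3) = m * (m * (m + 3) + 2 + j) := by
    subst hmm
    linear_combination hv
  have hdvd : m ∣ v 2 + v 3 := by
    have : m ∣ 2 * (v 2 + v 3) :=
      (Nat.dvd_add_right (Dvd.intro _ rfl)).mp (hv' ▸ Dvd.intro _ rfl)
    exact Nat.Coprime.dvd_of_dvd_mul_left hm.coprime_two_right this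
  obtain ⟨w, hw⟩ := hdvd
  have hred : v 0 * (m + 1) + v 1 * (m + 2) + w * (m * (m + 3) + 2) + v 3 =
      m * (m + 3) + 2 + j := by
    rw [hw] at hv'
    refine Nat.eq_of_mul_eq_mul_left hpos ?_
    linear_combination hv'
  obtain rfl | rfl | hw2 : w = 0 ∨ w = 1 ∨ 2 ≤ w := by omega
  · intro i
    fin_cases i <;> simp <;> omega
  · refine absurd ?_ hne
    have h0 : v 0 = 0 := by
      by_contra h
      nlinarith [Nat.pos_of_ne_zero h]
    have h1 : v 1 = 0 := by
      by_contra h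
      nlinarith [Nat.pos_of_ne_zero h]
    simp only [h0, h1] at hred
    ext i
    fin_cases i <;> simp [h0, h1] <;> omega
  · nlinarith [Nat.mul_le_mul_right (m * (m + 3) + 2) hw2]

theorem strictMono_bresinskyWeights {m : ℕ} (hm : 0 < m) : StrictMono (bresinskyWeights m) := by
  rw [Fin.strictMono_iff_lt_succ]
  intro i
  fin_cases i <;> simp [bresinskyWeights] <;> nlinarith

/-- If every weight is less than twice any other, no weight is a combination of the others. -/
theorem ne_zero_of_sum_mul_eq_of_lt_two_mul {σ : Type*} [Fintype σ] {n : σ → ℕ}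
    (hn : Function.Injective n) (h2 : ∀ i j, n i < 2 * n j) {i : σ} {c : σ → ℕ}
    (hc : ∑ j, c j * n j = n i) : c i ≠ 0 := by
  classical
  intro hci
  obtain ⟨j, -, hj⟩ := Finset.exists_ne_zero_of_sum_ne_zero
    (show ∑ j, c j * n j ≠ 0 by have := h2 i i; omega)
  have hcj := Nat.pos_of_ne_zero (left_ne_zero_of_mul hj)
  rw [← Finset.add_sum_erase _ _ (Finset.mem_univ j)] at hc
  by_cases hrest : ∑ l ∈ Finset.univ.erase j, c l * n l = 0
  · have hcj1 : c j = 1 := by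
      by_contra hne
      nlinarith [h2 i j, show 2 ≤ c j by omega]
    rw [hrest, hcj1, one_mul, add_zero] at hc
    rw [hn hc] at hcj
    omega
  · obtain ⟨l, hl, hl0⟩ := Finset.exists_ne_zero_of_sum_ne_zero hrest
    have hle := Finset.single_le_sum (f := fun l => c l * n l) (by simp) hl
    have hcl := Nat.pos_of_ne_zero (left_ne_zero_of_mul hl0)
    nlinarith [h2 i j, h2 i l]

theorem hasIsolatedFactorizations_bresinskyWeights {m M : ℕ} (hm : Odd m) (hm3 : 3 ≤ m)
    (hM : M ≤ m + 1) : HasIsolatedFactorizations (bresinskyWeights m) M where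
  pos i := by
    fin_cases i <;> simp [bresinskyWeights] <;> omega
  strictMono := strictMono_bresinskyWeights (by omega)
  eq_one_of_dvd d hd := by
    have h2 : d ∣ m * (m + 3) + 2 := hd 2
    have h3 : d ∣ m * (m + 4) + 2 := hd 3
    have hdm : d ∣ m := by
      rw [show m * (m + 4) + 2 = m * (m + 3) + 2 + m by ring] at h3
      exact (Nat.dvd_add_right h2).mp h3
    have hd2 : d ∣ 2 := (Nat.dvd_add_right (hdm.mul_right _)).mp h2
    exact Nat.eq_one_of_dvd_coprimes hm.coprime_two_right hdm hd2
  minimal i c hc := by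
    refine ne_zero_of_sum_mul_eq_of_lt_two_mul (strictMono_bresinskyWeights (by omega)).injective
      (fun i j => ?_) hc
    have hle : bresinskyWeights m i ≤ m * (m + 4) + 2 := by
      fin_cases i <;> simp [bresinskyWeights] <;> nlinarith
    have hge : m * (m + 1) ≤ bresinskyWeights m j := by
      fin_cases j <;> simp [bresinskyWeights] <;> nlinarith
    nlinarith
  exists_isolated := by
    refine ⟨fun j => ![0, 0, m - j, j], fun a b hab => ?_, fun j =>
      isIsolatedFactorization_bresinskyWeights hm (by omega)⟩
    obtain ⟨x, hx⟩ := Nat.exists_eq_add_of_le (show (a : ℕ) ≤ m by omega)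
    obtain ⟨y, hy⟩ := Nat.exists_eq_add_of_le (show (b : ℕ) ≤ m by omega)
    have hax : m - a = x := by omega
    have hby : m - b = y := by omega
    simp only [bresinskyWeights, Fin.sum_univ_four, Matrix.cons_val, hax, hby] at hab
    have : m * (a : ℕ) = m * b := by
      have h : x + a = y + b := by omega
      have := congrArg (· * (m * (m + 3) + 2)) h
      linarith
    exact Fin.ext (Nat.eq_of_mul_eq_mul_left (by omega) this)

/-- Doubling the weights and adjoining a large odd weight preserves isolated factorizations. -/
theorem HasIsolatedFactorizations.exists_succ {p M : ℕ} {n : Fin (p + 1) → ℕ}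
    (h : HasIsolatedFactorizations n M) :
    ∃ n' : Fin (p + 2) → ℕ, HasIsolatedFactorizations n' M := by
  obtain ⟨u, hinj, hu⟩ := h.exists_isolated
  obtain ⟨B, hBn, hBu⟩ : ∃ B, (∀ i, n i ≤ B) ∧ ∀ j, ∑ i, u j i * n i ≤ B :=
    ⟨∑ i, n i + ∑ j, ∑ i, u j i * n i,
      fun i => (Finset.single_le_sum (f := n) (by simp) (Finset.mem_univ i)).trans (by simp),
      fun j => (Finset.single_le_sum (f := fun j => ∑ i, u j i * n i) (by simp)
        (Finset.mem_univ j)).trans (by simp)⟩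
  have hsum : ∀ c : Fin (p + 2) → ℕ,
      ∑ i, c i * (Fin.snoc (fun i => 2 * n i) (2 * B + 1) : Fin (p + 2) → ℕ) i =
        2 * ∑ i : Fin (p + 1), c i.castSucc * n i + c (Fin.last _) * (2 * B + 1) := by
    intro c
    rw [Fin.sum_univ_castSucc, Finset.mul_sum]
    simp only [Fin.snoc_castSucc, Fin.snoc_last, mul_left_comm]
  have hlast : ∀ {c x w : ℕ}, w ≤ B → 2 * x + c * (2 * B + 1) = 2 * w → c = 0 ∧ x = w := by
    intro c x w hw hc
    obtain rfl : c = 0 := by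
      by_contra hc0
      nlinarith [Nat.pos_of_ne_zero hc0]
    omega
  refine ⟨Fin.snoc (fun i => 2 * n i) (2 * B + 1), ?_, ?_, ?_, ?_,
    fun j => Fin.snoc (u j) 0, ?_, fun j => ?_⟩
  · intro i
    induction i using Fin.lastCases with
    | last => simp
    | cast i => simpa using h.pos i
  · rw [Fin.strictMono_iff_lt_succ]
    intro i
    induction i using Fin.lastCases with
    | last =>
      have := hBn (Fin.last p)
      simp only [Fin.succ_last, Fin.snoc_castSucc, Fin.snoc_last]
      omega
    | cast i =>
      have := h.strictMono (Fin.castSucc_lt_succ (i := i))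
      simp only [Fin.succ_castSucc, Fin.snoc_castSucc]
      omega
  · intro d hd
    have hodd : d ∣ 2 * B + 1 := by simpa using hd (Fin.last _)
    have hcop : Nat.Coprime d 2 :=
      Nat.Coprime.coprime_dvd_left hodd (odd_two_mul_add_one B).coprime_two_right
    exact h.eq_one_of_dvd d fun i => hcop.dvd_of_dvd_mul_left (by simpa using hd i.castSucc)
  · intro i c hc
    rw [hsum] at hc
    induction i using Fin.lastCases with
    | last =>
      rw [Fin.snoc_last] at hc
      intro h0
      rw [h0] at hc
      omega
    | cast i =>
      rw [Fin.snoc_castSucc] at hc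
      exact h.minimal i (fun i => c i.castSucc) (hlast (hBn i) hc).2
  · intro a b hab
    simp only [hsum, Fin.snoc_castSucc, Fin.snoc_last] at hab
    exact hinj (show ∑ i, u a i * n i = ∑ i, u b i * n i by omega)
  · obtain ⟨⟨v, hvne, hv⟩, hdisj⟩ := hu j
    refine ⟨⟨Fin.snoc v 0, fun heq => hvne ?_, ?_⟩, fun c hc hne => ?_⟩
    · ext i
      simpa using congrFun heq i.castSucc
    · simp [hsum, hv]
    · simp only [hsum, Fin.snoc_castSucc, Fin.snoc_last, zero_mul, add_zero] at hc
      obtain ⟨hc0, hcw⟩ := hlast (hBu j) hc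
      have := hdisj (fun i => c i.castSucc) hcw fun heq => hne (by
        ext i
        induction i using Fin.lastCases with
        | last => simpa using hc0
        | cast i => simpa using congrFun heq i)
      intro i
      induction i using Fin.lastCases with
      | last => simp
      | cast i => simpa using this i

theorem exists_hasIsolatedFactorizations {p : ℕ} (hp : 3 ≤ p) (M : ℕ) :
    ∃ n : Fin (p + 1) → ℕ, HasIsolatedFactorizations n M := by
  induction p, hp using Nat.le_induction with
  | base =>
    exact ⟨_, hasIsolatedFactorizations_bresinskyWeights (m := 2 * M + 3)
      ⟨M + 1, by ring⟩ (by omega) (by omega)⟩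
  | succ p _ ih =>
    obtain ⟨n, hn⟩ := ih
    exact hn.exists_succ

/-- **Bresinsky: β₁ is unbounded in embedding dimension ≥ 4.**
For every `p ≥ 3` and every `N`, there exist positive integers `n₀ < n₁ < ⋯ < n_p`
with gcd `1`, minimally generating the numerical semigroup `Γ(n₀, …, n_p)`, such that
the defining ideal `𝔭(n₀, …, n_p) ⊆ k[x₀, …, x_p]` cannot be generated by `N`
elements. -/
theorem bresinsky_unbounded_first_betti (k : Type*) [Field k] (p : ℕ) (hp : 3 ≤ p)
    (N : ℕ) :
    ∃ n : Fin (p + 1) → ℕ, (∀ i, 0 < n i) ∧ StrictMono n ∧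
      (∀ d : ℕ, (∀ i, d ∣ n i) → d = 1) ∧
      (∀ i : Fin (p + 1),
        n i ∉ AddSubmonoid.closure {x : ℕ | ∃ j : Fin (p + 1), j ≠ i ∧ x = n j}) ∧
      ¬ ∃ s : Finset (MvPolynomial (Fin (p + 1)) k), s.card ≤ N ∧
          Ideal.span (s : Set (MvPolynomial (Fin (p + 1)) k)) =
            RingHom.ker (MvPolynomial.aeval (R := k) fun i => (X : k[X]) ^ n i).toRingHom := by
  obtain ⟨n, hn⟩ := exists_hasIsolatedFactorizations hp (N + 1)
  refine ⟨n, hn.pos, hn.strictMono, hn.eq_one_of_dvd, fun i hi => ?_, ?_⟩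
  · obtain ⟨c, hci, hc⟩ := exists_weights_of_mem_closure hi
    exact hn.minimal i c hc hci
  · rintro ⟨s, hcard, hs⟩
    obtain ⟨u, hinj, hu⟩ := hn.exists_isolated
    have := card_le_card_of_span_eq_monomialCurveIdeal
      (fun j => Finsupp.equivFunOnFinite.symm (u j)) hinj hu s hs
    rw [Fintype.card_fin] at this
    omega
end

section
/- (β₂(4) = ∞) For every positive integer N there exist positive integers n₀, n₁, n₂, n₃ with gcd 1 such that for every finite generating set G = {g₁,...,g_t} of the defining ideal 𝔭(n₀,n₁,n₂,n₃) ⊆ R = k[x₀,x₁,x₂,x₃], the syzygy module Syz(g₁,...,g_t) = ker(R^t → R, e_k ↦ g_k) cannot be generated by fewer than N elements. -/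
open Polynomial

namespace MonomialCurve

section General

variable {k σ : Type*} [Field k]

/-- The parametrization `x_i ↦ t ^ n_i` restricted to the coordinate subspace on which the
variables outside `J` vanish. -/
noncomputable def restrictedParam (k : Type*) [Field k] (n : σ → ℕ) (J : σ → Prop)
    [DecidablePred J] : MvPolynomial σ k →ₐ[k] k[X] :=
  MvPolynomial.aeval fun i => if J i then (X : k[X]) ^ n i else 0

theorem restrictedParam_monomial_of_exists (n : σ → ℕ) (J : σ → Prop) [DecidablePred J]
    (e : σ →₀ ℕ) (a : k) (he : ∃ i, e i ≠ 0 ∧ ¬ J i) :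
    restrictedParam k n J (MvPolynomial.monomial e a) = 0 := by
  obtain ⟨i, hi, hJ⟩ := he
  rw [restrictedParam, MvPolynomial.aeval_monomial]
  refine mul_eq_zero_of_right _ (Finset.prod_eq_zero (Finsupp.mem_support_iff.mpr hi) ?_)
  simp [hJ, hi]

variable [Fintype σ]

theorem aeval_monomial_pow (n : σ → ℕ) (e : σ →₀ ℕ) (a : k) :
    MvPolynomial.aeval (R := k) (fun i => (X : k[X]) ^ n i) (MvPolynomial.monomial e a) =
      monomial (∑ i, e i * n i) a := by
  rw [MvPolynomial.aeval_monomial, Finsupp.prod_fintype _ _ (by simp)]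
  simp only [← pow_mul, Finset.prod_pow_eq_pow_sum, ← C_mul_X_pow_eq_monomial, mul_comm (n _)]
  rfl

theorem restrictedParam_monomial_of_forall (n : σ → ℕ) (J : σ → Prop) [DecidablePred J]
    (e : σ →₀ ℕ) (a : k) (he : ∀ i, e i ≠ 0 → J i) :
    restrictedParam k n J (MvPolynomial.monomial e a) = monomial (∑ i, e i * n i) a := by
  rw [← aeval_monomial_pow, restrictedParam, MvPolynomial.aeval_monomial,
    MvPolynomial.aeval_monomial]
  congr 1
  refine Finsupp.prod_congr fun i hi => ?_
  rw [if_pos (he i (Finsupp.mem_support_iff.mp hi))]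

/-- If no monomial of weight `s` mixes variables in `J` with variables outside `J`, then the
`s`-th coefficient of the restricted parametrization vanishes on `x_i * h` for every `h` in the
ideal of the monomial curve. -/
theorem coeff_restrictedParam_X_mul (n : σ → ℕ) (J : σ → Prop) [DecidablePred J] (s : ℕ)
    (hs : ∀ e : σ →₀ ℕ, ∑ i, e i * n i = s → (∀ i, e i ≠ 0 → J i) ∨ ∀ i, e i ≠ 0 → ¬ J i)
    (i : σ) (h : MvPolynomial σ k)
    (hh : MvPolynomial.aeval (R := k) (fun i => (X : k[X]) ^ n i) h = 0) :
    (restrictedParam k n J (MvPolynomial.X i * h)).coeff s = 0 := by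
  by_cases hi : J i
  · have key : ∀ f : MvPolynomial σ k, (restrictedParam k n J (MvPolynomial.X i * f)).coeff s =
        (MvPolynomial.aeval (R := k) (fun i => (X : k[X]) ^ n i)
          (MvPolynomial.X i * f)).coeff s := by
      intro f
      induction f using MvPolynomial.induction_on' with
      | monomial e a =>
        have hX : MvPolynomial.X i * MvPolynomial.monomial e a =
            MvPolynomial.monomial (Finsupp.single i 1 + e) a := by
          rw [MvPolynomial.X, MvPolynomial.monomial_mul, one_mul]
        rw [hX, aeval_monomial_pow]
        by_cases hJ : ∀ j, (Finsupp.single i 1 + e : σ →₀ ℕ) j ≠ 0 → J j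
        · rw [restrictedParam_monomial_of_forall n J _ a hJ]
        · rw [restrictedParam_monomial_of_exists n J _ a (by simpa using hJ), coeff_zero,
            coeff_monomial, if_neg]
          intro hw
          exact (hs _ hw).elim hJ fun h' => h' i (by simp) hi
      | add p q hp hq => simp only [mul_add, map_add, coeff_add, hp, hq]
    rw [key, map_mul, hh, mul_zero, coeff_zero]
  · simp [restrictedParam, hi]

/-- If there are `r` distinct weights, each attained by a monomial in the variables of `J` and by
a monomial in the other variables, but by no mixed monomial, then the ideal of the monomial curve
needs at least `r` generators. -/
theorem le_card_generators (n : σ → ℕ) (J : σ → Prop) [DecidablePred J] {r t : ℕ}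
    (s : Fin r → ℕ) (hinj : Function.Injective s)
    (hs : ∀ m, ∀ e : σ →₀ ℕ, ∑ i, e i * n i = s m →
      (∀ i, e i ≠ 0 → J i) ∨ ∀ i, e i ≠ 0 → ¬ J i)
    (u v : Fin r → σ →₀ ℕ) (hu : ∀ m, ∑ i, u m i * n i = s m) (hv : ∀ m, ∑ i, v m i * n i = s m)
    (huJ : ∀ m i, u m i ≠ 0 → J i) (hvJ : ∀ m, ∃ i, v m i ≠ 0 ∧ ¬ J i)
    (g : Fin t → MvPolynomial σ k)
    (hg : Ideal.span (Set.range g) =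
      RingHom.ker (MvPolynomial.aeval (R := k) fun i => (X : k[X]) ^ n i).toRingHom) :
    r ≤ t := by
  let Φ : MvPolynomial σ k →ₗ[k] (Fin r → k) :=
    LinearMap.pi fun m => (lcoeff k (s m)).comp (restrictedParam k n J).toLinearMap
  have hΦ : ∀ f m, Φ f m = (restrictedParam k n J f).coeff (s m) := fun _ _ => rfl
  have hker : ∀ f, f ∈ Ideal.span (Set.range g) ↔
      MvPolynomial.aeval (R := k) (fun i => (X : k[X]) ^ n i) f = 0 := by
    intro f
    rw [hg, RingHom.mem_ker]
    rfl
  have hmul : ∀ c f, f ∈ Ideal.span (Set.range g) →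
      Φ (c * f) = MvPolynomial.constantCoeff c • Φ f := by
    intro c f hf
    induction c using MvPolynomial.induction_on with
    | C a => rw [← MvPolynomial.smul_eq_C_mul, map_smul, MvPolynomial.constantCoeff_C]
    | add p q hp hq => rw [add_mul, map_add, hp, hq, map_add, add_smul]
    | mul_X p i _ =>
      rw [map_mul MvPolynomial.constantCoeff, MvPolynomial.constantCoeff_X, mul_zero, zero_smul,
        mul_comm p, mul_assoc]
      ext m
      rw [hΦ]
      exact coeff_restrictedParam_X_mul n J _ (hs m) i _
        ((hker _).mp (Ideal.mul_mem_left _ _ hf))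
  have hmem : ∀ f ∈ Ideal.span (Set.range g),
      Φ f ∈ Submodule.span k (Set.range fun l => Φ (g l)) := by
    intro f hf
    obtain ⟨c, rfl⟩ := (Ideal.mem_span_range_iff_exists_fun).mp hf
    rw [map_sum]
    refine Submodule.sum_mem _ fun l _ => ?_
    rw [hmul _ _ (Ideal.subset_span ⟨l, rfl⟩)]
    exact Submodule.smul_mem _ _ (Submodule.subset_span ⟨l, rfl⟩)
  have htop : Submodule.span k (Set.range fun l => Φ (g l)) = ⊤ := by
    rw [eq_top_iff, ← (Pi.basisFun k (Fin r)).span_eq, Submodule.span_le]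
    rintro _ ⟨m, rfl⟩
    have hb : Pi.basisFun k (Fin r) m =
        Φ (MvPolynomial.monomial (u m) 1 - MvPolynomial.monomial (v m) 1) := by
      ext m'
      rw [hΦ, map_sub, restrictedParam_monomial_of_forall n J _ _ (huJ m),
        restrictedParam_monomial_of_exists n J _ _ (hvJ m), sub_zero, hu, coeff_monomial,
        Pi.basisFun_apply, Pi.single_apply]
      simp only [hinj.eq_iff, eq_comm]
    rw [hb]
    refine hmem _ ((hker _).mpr ?_)
    rw [map_sub, aeval_monomial_pow, aeval_monomial_pow, hu, hv, sub_self]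
  have := finrank_range_le_card (R := k) (fun l => Φ (g l))
  rwa [Set.finrank, htop, finrank_top, Module.finrank_fin_fun, Fintype.card_fin] at this

end General

/-- The syzygies of `t` elements of a domain, one of them nonzero, need at least `t - 1`
generators. -/
theorem card_le_card_syzygies_add_one {R : Type*} [CommRing R] [IsDomain R] {t : ℕ}
    (g : Fin t → R) (j : Fin t) (hj : g j ≠ 0) (T : Finset (Fin t → R))
    (hT : (Submodule.span R (T : Set (Fin t → R)) : Set (Fin t → R)) =
      {c : Fin t → R | ∑ l, c l * g l = 0}) :
    t ≤ T.card + 1 := by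
  let w : {l : Fin t // l ≠ j} → Fin t → R := fun l =>
    Pi.single (l : Fin t) (g j) - Pi.single j (g l)
  have hw : LinearIndependent R w := by
    rw [Fintype.linearIndependent_iff]
    intro c hc l
    have := congrFun hc l
    rw [Finset.sum_apply, Finset.sum_eq_single l] at this
    · simpa [w, l.2, hj] using this
    · intro b _ hb
      have : (l : Fin t) ≠ b := fun h => hb (Subtype.ext h.symm)
      simp [w, l.2, this]
    · simp
  have hrange : Set.range w ≤ Submodule.span R (T : Set (Fin t → R)) := by
    rintro _ ⟨l, rfl⟩
    rw [hT]
    simp [w, mul_sub, Finset.sum_sub_distrib, Pi.single_apply, mul_comm]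
  have := linearIndependent_le_span' w hw (T : Set (Fin t → R)) hrange
  simp only [Fintype.card_coe, Finset.coe_sort_coe, Fintype.card_subtype_compl, Fintype.card_fin,
    Fintype.card_unique, Cardinal.mk_fintype, Nat.cast_le] at this
  omega

/-- The Bresinsky weights `q(q+1), (q-1)(q+1), q(q+1)+(q-1), q(q-1)` with `q = 2r + 2`. -/
def bresinskyWeights (r : ℕ) : Fin 4 → ℕ :=
  ![(2 * r + 2) * (2 * r + 3), (2 * r + 1) * (2 * r + 3),
    (2 * r + 2) * (2 * r + 3) + (2 * r + 1), (2 * r + 2) * (2 * r + 1)]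

theorem bresinskyWeights_pos (r : ℕ) (i : Fin 4) : 0 < bresinskyWeights r i := by
  fin_cases i <;> simp [bresinskyWeights]

theorem eq_one_of_forall_dvd_bresinskyWeights (r d : ℕ) (hd : ∀ i, d ∣ bresinskyWeights r i) :
    d = 1 := by
  have h0 : d ∣ (2 * r + 2) * (2 * r + 3) := hd 0
  have h2 : d ∣ (2 * r + 2) * (2 * r + 3) + (2 * r + 1) := hd 2
  have h1 : d ∣ 2 * r + 1 := (Nat.dvd_add_right h0).mp h2
  have h3 : d ∣ 2 := by
    have h4 : (2 * r + 2) * (2 * r + 3) = (2 * r + 1) * (2 * r + 4) + 2 := by ring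
    rw [h4] at h0
    exact (Nat.dvd_add_right (h1.mul_right _)).mp h0
  have h5 : d ∣ 1 := (Nat.dvd_add_right (h3.mul_right r)).mp h1
  exact Nat.dvd_one.mp h5

/-- Arithmetic core: in these weights no relation mixes the two pairs of variables. -/
theorem bresinsky_no_mixing {r m a b c e : ℕ}
    (h : a * ((2 * r + 2) * (2 * r + 3)) + b * ((2 * r + 1) * (2 * r + 3)) +
      c * ((2 * r + 2) * (2 * r + 3) + (2 * r + 1)) + e * ((2 * r + 2) * (2 * r + 1)) +
      (2 * r + 1) * (m + 1) = (2 * r + 1) * ((2 * r + 2) * (2 * r + 4))) :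
    (b = 0 ∧ e = 0) ∨ (a = 0 ∧ c = 0) := by
  have hdvd : 2 * r + 1 ∣ a + c := by
    have h1 : 2 * r + 1 ∣ (a + c) * 2 := by
      zify at h ⊢
      refine ⟨(2 * r + 2) * (2 * r + 4) - (m + 1) - e * (2 * r + 2) - c - b * (2 * r + 3)
        - (a + c) * (2 * r + 4), ?_⟩
      linear_combination h
    refine Nat.Coprime.dvd_of_dvd_mul_right ?_ h1
    simp
  obtain ⟨x, hx⟩ := hdvd
  have hmain : x * ((2 * r + 2) * (2 * r + 3)) + c + b * (2 * r + 3) + e * (2 * r + 2) + (m + 1) =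
      (2 * r + 2) * (2 * r + 4) := by
    refine Nat.eq_of_mul_eq_mul_left (Nat.succ_pos (2 * r)) ?_
    rw [← h]
    zify at hx ⊢
    linear_combination -((2 * r + 2) * (2 * r + 3) : ℤ) * hx
  rcases Nat.lt_or_ge x 2 with hx2 | hx2
  · interval_cases x
    · right; omega
    · left
      constructor
      · by_contra hb
        have := Nat.mul_le_mul_right (2 * r + 3) (Nat.one_le_iff_ne_zero.mpr hb)
        nlinarith
      · by_contra he
        have := Nat.mul_le_mul_right (2 * r + 2) (Nat.one_le_iff_ne_zero.mpr he)
        nlinarith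
  · have := Nat.mul_le_mul_right ((2 * r + 2) * (2 * r + 3)) hx2
    nlinarith

theorem le_card_generators_bresinsky {k : Type*} [Field k] (r : ℕ) {t : ℕ}
    (g : Fin t → MvPolynomial (Fin 4) k)
    (hg : Ideal.span (Set.range g) = RingHom.ker
      (MvPolynomial.aeval (R := k) fun i => (X : k[X]) ^ bresinskyWeights r i).toRingHom) :
    2 * r + 2 ≤ t := by
  let J : Fin 4 → Prop := fun i => i = 0 ∨ i = 2
  let u : Fin (2 * r + 2) → Fin 4 →₀ ℕ := fun m =>
    Finsupp.equivFunOnFinite.symm ![m, 0, 2 * r + 1 - m, 0]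
  let v : Fin (2 * r + 2) → Fin 4 →₀ ℕ := fun m =>
    Finsupp.equivFunOnFinite.symm ![0, 2 * r + 1 - m, 0, m + 2]
  have hu : ∀ m, ∑ i, u m i * bresinskyWeights r i + (2 * r + 1) * (m + 1) =
      (2 * r + 1) * ((2 * r + 2) * (2 * r + 4)) := by
    intro m
    obtain ⟨y, hy⟩ := Nat.exists_eq_add_of_le (Nat.le_of_lt_succ m.2)
    have hy' : 2 * r + 1 - (m : ℕ) = y := by omega
    simp [Fin.sum_univ_four, u, bresinskyWeights, hy']
    zify at hy ⊢
    linear_combination -(4 * r ^ 2 + 12 * r + 7 : ℤ) * hy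
  have hv : ∀ m, ∑ i, v m i * bresinskyWeights r i = ∑ i, u m i * bresinskyWeights r i := by
    intro m
    refine Nat.add_right_cancel ((?_ : _ = _).trans (hu m).symm)
    obtain ⟨y, hy⟩ := Nat.exists_eq_add_of_le (Nat.le_of_lt_succ m.2)
    have hy' : 2 * r + 1 - (m : ℕ) = y := by omega
    simp [Fin.sum_univ_four, v, bresinskyWeights, hy']
    zify at hy ⊢
    linear_combination -((2 * r + 1) * (2 * r + 3) : ℤ) * hy
  refine le_card_generators (k := k) (bresinskyWeights r) J
    (fun m => ∑ i, u m i * bresinskyWeights r i) ?_ ?_ u v (fun _ => rfl) hv ?_ ?_ g hg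
  · intro m m' hmm
    have h1 := hu m
    have h2 := hu m'
    simp only at hmm
    rw [hmm, ← h2] at h1
    have := Nat.eq_of_mul_eq_mul_left (Nat.succ_pos (2 * r)) (Nat.add_left_cancel h1)
    exact Fin.ext (Nat.succ_injective this)
  · intro m e he
    have h := hu m
    rw [← he] at h
    simp only [Fin.sum_univ_four, bresinskyWeights] at h
    rcases bresinsky_no_mixing h with ⟨h1, h2⟩ | ⟨h1, h2⟩
    · left
      intro i hi
      fin_cases i <;> simp_all [J]
    · right
      intro i hi
      fin_cases i <;> simp_all [J]
  · intro m i hi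
    fin_cases i <;> simp_all [J, u]
  · intro m
    exact ⟨3, by simp [v], by simp [J]⟩

end MonomialCurve


/-- **β₂(4) = ∞.** For every `N` there exist positive integers
`n₀, n₁, n₂, n₃` with gcd `1` such that for every finite generating set
`g₁, …, g_t` of the defining ideal `𝔭(n₀,n₁,n₂,n₃) ⊆ R = k[x₀,x₁,x₂,x₃]`, the
syzygy module `{c ∈ R^t : Σ c_k g_k = 0}` cannot be generated by fewer than `N`
elements. -/
theorem unbounded_second_betti_dim_four (k : Type*) [Field k] (N : ℕ) :
    ∃ n : Fin 4 → ℕ, (∀ i, 0 < n i) ∧ (∀ d : ℕ, (∀ i, d ∣ n i) → d = 1) ∧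
      ∀ (t : ℕ) (g : Fin t → MvPolynomial (Fin 4) k),
        Ideal.span (Set.range g) =
          RingHom.ker (MvPolynomial.aeval (R := k) fun i => (X : k[X]) ^ n i).toRingHom →
        ∀ T : Finset (Fin t → MvPolynomial (Fin 4) k),
          (Submodule.span (MvPolynomial (Fin 4) k)
              (T : Set (Fin t → MvPolynomial (Fin 4) k)) : Set (Fin t → MvPolynomial (Fin 4) k)) =
            {c : Fin t → MvPolynomial (Fin 4) k | ∑ l, c l * g l = 0} →
          N ≤ T.card := by
  refine ⟨MonomialCurve.bresinskyWeights N, MonomialCurve.bresinskyWeights_pos N,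
    MonomialCurve.eq_one_of_forall_dvd_bresinskyWeights N, fun t g hg T hT => ?_⟩
  have ht := MonomialCurve.le_card_generators_bresinsky N g hg
  by_cases hzero : ∃ j, g j ≠ 0
  · obtain ⟨j, hj⟩ := hzero
    have := MonomialCurve.card_le_card_syzygies_add_one g j hj T hT
    omega
  · have hbot : Ideal.span (Set.range (Fin.elim0 : Fin 0 → MvPolynomial (Fin 4) k)) =
        Ideal.span (Set.range g) := by
      push Not at hzero
      rw [Set.range_eq_empty, Ideal.span_empty, eq_comm, Ideal.span_eq_bot]
      rintro _ ⟨l, rfl⟩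
      exact hzero l
    have := MonomialCurve.le_card_generators_bresinsky N _ (hbot.trans hg)
    omega
end

section
/- Let p ≥ 3 and let n₀ < n₁ < ... < n_p be an arithmetic sequence of positive integers (n_i = n₀ + i·d for a fixed positive integer d) with gcd(n₀, d) = 1, which minimally generates the numerical semigroup Γ(n₀,...,n_p). Then the defining ideal 𝔭(n₀,...,n_p) ⊆ k[x₀,...,x_p] is not a complete intersection: it cannot be generated by p elements. -/
open Polynomial

namespace ArithmeticSequence

/-- A polynomial in the kernel of a monomial parametrization has zero coefficient at every
exponent which is determined by its weight. -/
lemma coeff_eq_zero_of_weight_unique {k σ : Type*} [Field k] [Fintype σ] {n : σ → ℕ}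
    {f : MvPolynomial σ k} (hf : MvPolynomial.aeval (fun i => (X : k[X]) ^ n i) f = 0)
    (b : σ →₀ ℕ) (hb : ∀ b' : σ →₀ ℕ, ∑ i, n i * b' i = ∑ i, n i * b i → b' = b) :
    f.coeff b = 0 := by
  classical
  have h := congrArg (fun g : k[X] => g.coeff (∑ i, n i * b i)) hf
  rw [MvPolynomial.aeval_def, MvPolynomial.eval₂_eq'] at h
  simp only [← pow_mul, Finset.prod_pow_eq_pow_sum, finsetSum_coeff, algebraMap_eq,
    coeff_C_mul_X_pow, coeff_zero] at h
  rw [Finset.sum_eq_single b] at h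
  · simpa using h
  · intro b' _ hne
    exact if_neg fun h' => hne (hb b' h'.symm)
  · intro hb'
    simpa using hb'

/-- If `f` has no terms of degree less than two, then the coefficients of `g * f` in degree two
only depend on the constant coefficient of `g`. -/
lemma coeff_mul_of_degree_two {k σ : Type*} [Field k] {f : MvPolynomial σ k}
    (h0 : f.coeff 0 = 0) (h1 : ∀ i, f.coeff (Finsupp.single i 1) = 0)
    (g : MvPolynomial σ k) (a b : σ) :
    (g * f).coeff (Finsupp.single a 1 + Finsupp.single b 1) =
      g.coeff 0 * f.coeff (Finsupp.single a 1 + Finsupp.single b 1) := by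
  classical
  rw [MvPolynomial.coeff_mul]
  refine Finset.sum_eq_single (0, Finsupp.single a 1 + Finsupp.single b 1) ?_ ?_
  · rintro ⟨u, v⟩ huv hne
    rw [Finset.HasAntidiagonal.mem_antidiagonal] at huv
    have hdeg := congrArg Finsupp.degree huv
    simp only [map_add, Finsupp.degree_single] at hdeg
    by_cases hv0 : v.degree = 0
    · rw [Finsupp.degree_eq_zero_iff] at hv0
      simp [hv0, h0]
    by_cases hv1 : v.degree = 1
    · obtain ⟨i, hi⟩ := Finsupp.ne_iff.1 (mt (Finsupp.degree_eq_zero_iff v).2 hv0)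
      obtain ⟨w, rfl⟩ := le_iff_exists_add.1
        (Finsupp.single_le_iff.2 (Nat.one_le_iff_ne_zero.2 hi))
      have hw : w = 0 := by
        rw [← Finsupp.degree_eq_zero_iff]
        simpa using hv1
      simp [hw, h1]
    have hu : u = 0 := by rw [← Finsupp.degree_eq_zero_iff]; omega
    subst hu
    simp_all
  · intro h
    simp at h

/-- An exponent whose weight is that of a variable not generated by the others is that variable. -/
lemma eq_single_of_weight_eq {σ : Type*} [Fintype σ] {n : σ → ℕ} (hpos : ∀ i, 0 < n i) {i : σ}
    (hi : n i ∉ AddSubmonoid.closure {x : ℕ | ∃ j, j ≠ i ∧ x = n j})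
    {b : σ →₀ ℕ} (hb : ∑ j, n j * b j = n i) : b = Finsupp.single i 1 := by
  classical
  have hbi : b i ≠ 0 := by
    intro h0
    refine hi (hb ▸ AddSubmonoid.sum_mem _ fun j _ => ?_)
    by_cases hj : j = i
    · simp [hj, h0]
    · rw [mul_comm, ← smul_eq_mul]
      have hmem : n j ∈ {x : ℕ | ∃ j, j ≠ i ∧ x = n j} := ⟨j, hj, rfl⟩
      exact AddSubmonoid.nsmul_mem _ (AddSubmonoid.subset_closure hmem) _
  have hsum := Finset.add_sum_erase Finset.univ (fun j => n j * b j) (Finset.mem_univ i)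
  simp only [hb] at hsum
  have hge : n i * 1 ≤ n i * b i := Nat.mul_le_mul_left _ (Nat.pos_of_ne_zero hbi)
  have hrest : ∑ j ∈ Finset.univ.erase i, n j * b j = 0 := by omega
  have heq : n i * b i = n i * 1 := by omega
  ext j
  by_cases hj : j = i
  · subst hj
    simpa using Nat.eq_of_mul_eq_mul_left (hpos j) heq
  · have := Finset.sum_eq_zero_iff.1 hrest j (by simp [hj])
    have hne := (hpos j).ne'
    rw [Finsupp.single_eq_of_ne hj]
    exact (Nat.mul_eq_zero.1 this).resolve_left hne

/-- Suppose that `p` elements generate an ideal whose elements have no terms of degree less than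
two, and which contains `p` elements `q j` that are dual to quadratic monomials. If all `q j`
vanish on the diagonal, then so do all the generators. -/
lemma diagonal_eq_zero {k σ ι : Type*} [Field k] [Fintype ι] [DecidableEq ι]
    {f q : ι → MvPolynomial σ k} (hq : ∀ j, q j ∈ Ideal.span (Set.range f))
    (h0 : ∀ l, (f l).coeff 0 = 0) (h1 : ∀ l i, (f l).coeff (Finsupp.single i 1) = 0)
    (a b : ι → σ)
    (hdual : ∀ j i, (q j).coeff (Finsupp.single (a i) 1 + Finsupp.single (b i) 1) =
      if j = i then 1 else 0)
    (hdiag : ∀ j, MvPolynomial.aeval (fun _ => (X : k[X])) (q j) = 0) (l : ι) :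
    MvPolynomial.aeval (fun _ => (X : k[X])) (f l) = 0 := by
  simp only [Ideal.mem_span_range_iff_exists_fun] at hq
  choose g hg using hq
  let φ : MvPolynomial σ k →ₐ[k] k[X] := MvPolynomial.aeval fun _ => X
  let G : Matrix ι ι k := .of fun j l => (g j l).coeff 0
  let M : Matrix ι ι k[X] := .of fun j l => φ (g j l)
  have hG : G * .of (fun l i => (f l).coeff (Finsupp.single (a i) 1 + Finsupp.single (b i) 1)) =
      1 := by
    ext j i
    rw [Matrix.one_apply, ← hdual, ← hg, Matrix.mul_apply, MvPolynomial.coeff_sum]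
    exact Finset.sum_congr rfl fun l _ => (coeff_mul_of_degree_two (h0 l) (h1 l) _ _ _).symm
  have hGM : (evalRingHom 0).mapMatrix M = G := by
    ext j l
    have : ((evalRingHom (0 : k)).comp φ.toRingHom) = MvPolynomial.constantCoeff := by
      ext <;> simp [φ]
    exact DFunLike.congr_fun this (g j l)
  have hdet : M.det ≠ 0 := by
    intro h
    have hG0 : G.det = 0 := by rw [← hGM, ← RingHom.map_det, h, map_zero]
    have := congrArg Matrix.det hG
    simp [Matrix.det_mul, hG0] at this
  have hmul : M.mulVec (fun l => φ (f l)) = 0 := by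
    ext1 j
    have := congrArg φ (hg j)
    rw [map_sum] at this
    simpa [Matrix.mulVec, dotProduct, M, φ, hdiag] using this
  exact congrFun (Matrix.eq_zero_of_mulVec_eq_zero hdet hmul) l

/-- The coefficient of `x_u x_v` in `x_a x_b - x_c x_e`, when `x_c x_e ≠ x_u x_v`. -/
lemma coeff_X_mul_X_sub {k σ : Type*} [Field k] [DecidableEq σ] (a b c e u v : σ)
    (h : ¬ (c = u ∧ e = v ∨ c = v ∧ e = u)) :
    (MvPolynomial.X a * MvPolynomial.X b - MvPolynomial.X c * MvPolynomial.X e :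
      MvPolynomial σ k).coeff (Finsupp.single u 1 + Finsupp.single v 1) =
      if a = u ∧ b = v ∨ a = v ∧ b = u then 1 else 0 := by
  simp only [MvPolynomial.X, MvPolynomial.monomial_mul, MvPolynomial.coeff_sub,
    MvPolynomial.coeff_monomial]
  simp [Finsupp.single_add_single_eq_single_add_single, h]

end ArithmeticSequence

open ArithmeticSequence in
/-- Let `p ≥ 3` and let `n₀ < n₁ < ⋯ < n_p` be an arithmetic
sequence of positive integers (`nᵢ = n₀ + i·d`, `d > 0`, `gcd(n₀,d) = 1`) minimally
generating the numerical semigroup `Γ(n₀, …, n_p)`.  Then the defining ideal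
`𝔭(n₀, …, n_p) ⊆ k[x₀, …, x_p]` is not a complete intersection: it cannot be
generated by `p` elements. -/
theorem arithmetic_sequence_not_complete_intersection (k : Type*) [Field k]
    (p : ℕ) (hp : 3 ≤ p) (n : Fin (p + 1) → ℕ) (d : ℕ) (hd : 0 < d)
    (hn0 : 0 < n 0) (harith : ∀ i : Fin (p + 1), n i = n 0 + (i : ℕ) * d)
    (hgcd : Nat.gcd (n 0) d = 1)
    (hmin : ∀ i : Fin (p + 1),
      n i ∉ AddSubmonoid.closure {x : ℕ | ∃ j : Fin (p + 1), j ≠ i ∧ x = n j}) :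
    ¬ ∃ f : Fin p → MvPolynomial (Fin (p + 1)) k,
        Ideal.span (Set.range f) =
          RingHom.ker (MvPolynomial.aeval (R := k) fun i => (X : k[X]) ^ n i).toRingHom := by
  rintro ⟨f, hf⟩
  have hpos : ∀ i, 0 < n i := fun i => by rw [harith]; omega
  have hker (g : MvPolynomial (Fin (p + 1)) k) : g ∈ Ideal.span (Set.range f) ↔
      MvPolynomial.aeval (fun i => (X : k[X]) ^ n i) g = 0 := by
    rw [hf]; rfl
  have hmem (l : Fin p) := (hker (f l)).1 (Ideal.subset_span ⟨l, rfl⟩)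
  have h0 (l : Fin p) : (f l).coeff 0 = 0 :=
    coeff_eq_zero_of_weight_unique (hmem l) 0 fun b hb => by
      ext i
      have := Finset.sum_eq_zero_iff.1 (hb.trans (by simp)) i (Finset.mem_univ i)
      exact (Nat.mul_eq_zero.1 this).resolve_left (hpos i).ne'
  have h1 (l : Fin p) (i : Fin (p + 1)) : (f l).coeff (Finsupp.single i 1) = 0 :=
    coeff_eq_zero_of_weight_unique (hmem l) _ fun b hb =>
      eq_single_of_weight_eq hpos (hmin i) (hb.trans (by simp [Finsupp.single_apply]))
  -- The quadrics `x_{j+1}² - x_j x_{j+2}` for `j < p - 1`, together with `x₁ x₂ - x₀ x₃`.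
  let a : Fin p → Fin (p + 1) := fun j =>
    if h : j.1 < p - 1 then ⟨j + 1, by omega⟩ else ⟨1, by omega⟩
  let b : Fin p → Fin (p + 1) := fun j =>
    if h : j.1 < p - 1 then ⟨j + 1, by omega⟩ else ⟨2, by omega⟩
  let c : Fin p → Fin (p + 1) := fun j =>
    if h : j.1 < p - 1 then ⟨j, by omega⟩ else ⟨0, by omega⟩
  let e : Fin p → Fin (p + 1) := fun j =>
    if h : j.1 < p - 1 then ⟨j + 2, by omega⟩ else ⟨3, by omega⟩
  have hsum (j : Fin p) : (a j + b j : ℕ) = c j + e j := by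
    by_cases h : j.1 < p - 1 <;> simp only [a, b, c, e, h, dite_true, dite_false] <;> omega
  have hdisj (j i : Fin p) : ¬ (c j = a i ∧ e j = b i ∨ c j = b i ∧ e j = a i) := by
    by_cases h : j.1 < p - 1 <;> by_cases h' : i.1 < p - 1 <;>
      simp only [a, b, c, e, h, h', dite_true, dite_false, Fin.mk.injEq] <;> omega
  have hinj (j i : Fin p) : (a j = a i ∧ b j = b i ∨ a j = b i ∧ b j = a i) ↔ j = i := by
    by_cases h : j.1 < p - 1 <;> by_cases h' : i.1 < p - 1 <;>
      simp only [a, b, h, h', dite_true, dite_false, Fin.ext_iff, and_self, true_or, true_iff] <;>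
      omega
  have hzero := diagonal_eq_zero (f := f)
    (q := fun j => .X (a j) * .X (b j) - .X (c j) * .X (e j))
    (fun j => by
      have hn : n (a j) + n (b j) = n (c j) + n (e j) := by
        simp only [harith (a j), harith (b j), harith (c j), harith (e j)]
        linear_combination d * hsum j
      rw [hker]
      simp [← pow_add, hn])
    h0 h1 a b
    (fun j i => by
      rw [coeff_X_mul_X_sub _ _ _ _ _ _ (hdisj j i)]
      simp only [hinj])
    (fun j => by simp)
  let last : Fin (p + 1) := Fin.last p
  have hbin : (.X 0 ^ n last - .X last ^ n 0 : MvPolynomial (Fin (p + 1)) k) ∈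
      Ideal.span (Set.range f) := by
    rw [hker]
    simp [← pow_mul, mul_comm]
  have hle : Ideal.span (Set.range f) ≤
      RingHom.ker (MvPolynomial.aeval (R := k) fun _ : Fin (p + 1) => (X : k[X])) := by
    rw [Ideal.span_le]
    rintro _ ⟨l, rfl⟩
    exact hzero l
  have hX : (X : k[X]) ^ n last = X ^ n 0 := by
    simpa [RingHom.mem_ker, sub_eq_zero] using hle hbin
  have hn : n last = n 0 := by simpa using congrArg natDegree hX
  have hpd : 0 < p * d := Nat.mul_pos (by omega) hd
  rw [harith last] at hn
  simp only [last, Fin.val_last] at hn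
  omega
end

section
/- (Cowsik–Nori, monomial curve case) Let k be a field of positive characteristic, and n₀,...,n_p positive integers with gcd 1. Then the defining ideal 𝔭(n₀,...,n_p) ⊆ k[x₀,...,x_p] is a set-theoretic complete intersection: there exist p polynomials f₁,...,f_p ∈ k[x₀,...,x_p] such that 𝔭(n₀,...,n_p) equals the radical of the ideal (f₁,...,f_p). -/
open Polynomial

/-- If the `n i` are setwise coprime, `1 < q` and `0 < a`, then some `q ^ s * a` lies in
the numerical semigroup generated by the `n i`. -/
theorem exists_sum_mul_eq_pow_mul {ι : Type*} [Fintype ι] {n : ι → ℕ}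
    (hgcd : ∀ d : ℕ, (∀ i, d ∣ n i) → d = 1) {q : ℕ} (hq : 1 < q) {a : ℕ} (ha : 0 < a) :
    ∃ (s : ℕ) (c : ι → ℕ), ∑ i, c i * n i = q ^ s * a := by
  obtain ⟨N, hN⟩ := Nat.exists_mem_closure_of_ge (Set.range n)
  have hone : Nat.setGcd (Set.range n) = 1 :=
    hgcd _ fun i => Nat.setGcd_dvd_of_mem (Set.mem_range_self i)
  have hle : N ≤ q ^ N * a := (Nat.lt_pow_self hq).le.trans (Nat.le_mul_of_pos_right _ ha)
  have hmem := hN (q ^ N * a) hle (hone ▸ one_dvd _)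
  obtain ⟨c, hc⟩ := AddSubmonoid.exists_of_mem_closure_range n _ hmem
  exact ⟨N, c, by simpa using hc.symm⟩

/-- In characteristic `q > 0` there are `p` polynomials whose common zeros in every extension field
of `k` are exactly the points `(t ^ n₀, …, t ^ n_p)`. -/
theorem exists_polynomials_zeros_iff_monomial_curve.{u, v, w} {k : Type u} [Field k] {q : ℕ}
    (hq : q.Prime) [CharP k q] (p : ℕ) (n : Fin (p + 1) → ℕ) (hpos : ∀ i, 0 < n i)
    (hgcd : ∀ d : ℕ, (∀ i, d ∣ n i) → d = 1) :
    ∃ f : Fin p → MvPolynomial (Fin (p + 1)) k,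
      (∀ (j : Fin p) {A : Type v} [CommRing A] [Algebra k A] (t : A),
        MvPolynomial.aeval (fun i => t ^ n i) (f j) = 0) ∧
      ∀ {K : Type w} [Field K] [Algebra k K] (x : Fin (p + 1) → K),
        (∀ j, MvPolynomial.aeval x (f j) = 0) → ∃ t : K, ∀ i, x i = t ^ n i := by
  induction p with
  | zero =>
    have hn : n 0 = 1 := hgcd _ fun i => by rw [Fin.fin_one_eq_zero i]
    exact ⟨Fin.elim0, fun j => j.elim0, fun x _ => ⟨x 0, fun i => by
      rw [Fin.fin_one_eq_zero i, hn, pow_one]⟩⟩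
  | succ p ih =>
    obtain ⟨m, hm, hmgcd⟩ := Finset.extract_gcd (fun i : Fin (p + 1) => n i.castSucc)
      Finset.univ_nonempty
    set d := Finset.univ.gcd fun i : Fin (p + 1) => n i.castSucc
    replace hm : ∀ i : Fin (p + 1), n i.castSucc = d * m i := fun i => hm i (Finset.mem_univ i)
    set a := n (Fin.last (p + 1))
    have hmpos : ∀ i, 0 < m i := fun i => by
      have := hpos i.castSucc
      rw [hm] at this
      exact Nat.pos_of_mul_pos_left this
    have hmgcd' : ∀ e : ℕ, (∀ i, e ∣ m i) → e = 1 := fun e he =>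
      Nat.dvd_one.mp (hmgcd ▸ Finset.dvd_gcd fun i _ => he i)
    have hda : d.Coprime a := hgcd _ fun i => by
      induction i using Fin.lastCases with
      | last => exact Nat.gcd_dvd_right _ _
      | cast i => exact hm i ▸ (Nat.gcd_dvd_left d a).mul_right _
    obtain ⟨f, hf, hfK⟩ := ih m hmpos hmgcd'
    obtain ⟨s, c, hc⟩ := exists_sum_mul_eq_pow_mul hmgcd' hq.one_lt (hpos (Fin.last (p + 1)))
    refine ⟨Fin.lastCases
      (MvPolynomial.X (Fin.last _) ^ (d * q ^ s) - ∏ i, MvPolynomial.X (Fin.castSucc i) ^ c i)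
      fun j => MvPolynomial.rename Fin.castSucc (f j), ?_, ?_⟩
    · intro j A _ _ t
      induction j using Fin.lastCases with
      | last =>
        have hexp : a * (d * q ^ s) = ∑ i, d * m i * c i := by
          calc a * (d * q ^ s) = d * ∑ i, c i * m i := by rw [hc]; ring
            _ = ∑ i, d * m i * c i := by
              rw [Finset.mul_sum]
              exact Finset.sum_congr rfl fun i _ => by ring
        simp only [Fin.lastCases_last, map_sub, map_pow, map_prod, MvPolynomial.aeval_X, hm,
          ← pow_mul, Finset.prod_pow_eq_pow_sum]
        rw [← hexp, sub_self]
      | cast j =>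
        simp only [Fin.lastCases_castSucc, MvPolynomial.aeval_rename, Function.comp_def, hm,
          pow_mul]
        exact hf j _
    · intro K _ _ x hx
      obtain ⟨t, ht⟩ := hfK (x ∘ Fin.castSucc) fun j => by
        simpa only [Fin.lastCases_castSucc, MvPolynomial.aeval_rename] using hx j.castSucc
      replace ht : ∀ i : Fin (p + 1), x i.castSucc = t ^ m i := ht
      have hlast := hx (Fin.last p)
      simp only [Fin.lastCases_last, map_sub, map_pow, map_prod, MvPolynomial.aeval_X, ht,
        ← pow_mul, Finset.prod_pow_eq_pow_sum, sub_eq_zero, mul_comm (m _), hc] at hlast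
      rw [mul_comm (q ^ s), pow_mul, pow_mul] at hlast
      have : CharP K q := charP_of_injective_algebraMap (algebraMap k K).injective q
      have : ExpChar K q := ExpChar.prime hq
      obtain ⟨u, hu, hu'⟩ :=
        (pow_eq_pow_iff_of_coprime hda).mp (iterateFrobenius_inj K q s hlast)
      refine ⟨u, fun i => ?_⟩
      induction i using Fin.lastCases with
      | last => exact hu
      | cast i => rw [ht, hu', hm, pow_mul]

/-- **Cowsik–Nori, monomial curve case.** Let `k` be a field of
positive characteristic and `n₀, …, n_p` positive integers with gcd `1`.  Then the
defining ideal `𝔭(n₀, …, n_p) ⊆ k[x₀, …, x_p]` is a set-theoretic complete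
intersection: there exist `p` polynomials `f₁, …, f_p` with
`𝔭(n₀, …, n_p) = √(f₁, …, f_p)`. -/
theorem cowsik_nori_monomial_curve (k : Type*) [Field k] (hchar : ringChar k ≠ 0)
    (p : ℕ) (n : Fin (p + 1) → ℕ) (hpos : ∀ i, 0 < n i)
    (hgcd : ∀ d : ℕ, (∀ i, d ∣ n i) → d = 1) :
    ∃ f : Fin p → MvPolynomial (Fin (p + 1)) k,
      RingHom.ker (MvPolynomial.aeval (R := k) fun i => (X : k[X]) ^ n i).toRingHom =
        (Ideal.span (Set.range f)).radical := by
  have hq : (ringChar k).Prime := (CharP.char_is_prime_or_zero k (ringChar k)).resolve_right hchar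
  obtain ⟨f, hf, hfK⟩ := exists_polynomials_zeros_iff_monomial_curve (k := k) hq p n hpos hgcd
  refine ⟨f, le_antisymm ?_ ?_⟩
  · rw [Ideal.radical_eq_sInf]
    refine le_sInf fun P ⟨hle, hP⟩ g hg => ?_
    let K := FractionRing (MvPolynomial (Fin (p + 1)) k ⧸ P)
    let φ : MvPolynomial (Fin (p + 1)) k →ₐ[k] K :=
      (IsScalarTower.toAlgHom k (MvPolynomial (Fin (p + 1)) k ⧸ P) K).comp (Ideal.Quotient.mkₐ k P)
    have hφ : ∀ g, φ g = 0 ↔ g ∈ P := fun g =>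
      (FaithfulSMul.algebraMap_eq_zero_iff (MvPolynomial (Fin (p + 1)) k ⧸ P) K).trans
        Ideal.Quotient.eq_zero_iff_mem
    obtain ⟨t, ht⟩ := hfK (φ ∘ MvPolynomial.X) fun j => by
      rw [← MvPolynomial.aeval_unique]
      exact (hφ _).mpr (hle (Ideal.subset_span ⟨j, rfl⟩))
    have hfac : φ = (aeval t).comp (MvPolynomial.aeval fun i => (X : k[X]) ^ n i) :=
      MvPolynomial.algHom_ext fun i => by simpa using ht i
    have hg' : MvPolynomial.aeval (fun i => (X : k[X]) ^ n i) g = 0 := hg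
    rw [← hφ, hfac, AlgHom.comp_apply, hg', map_zero]
  · refine ((RingHom.ker_isPrime _).radical_le_iff).mpr (Ideal.span_le.mpr ?_)
    rintro _ ⟨j, rfl⟩
    exact hf j X
end

section
/- (Bresinsky) Let k be a field and n₀, n₁, n₂ positive integers with gcd(n₀,n₁,n₂) = 1. Then the defining ideal 𝔭(n₀,n₁,n₂) ⊆ k[x₀,x₁,x₂] is a set-theoretic complete intersection: there exist polynomials f₁, f₂ ∈ k[x₀,x₁,x₂] such that 𝔭(n₀,n₁,n₂) equals the radical of the ideal (f₁, f₂). -/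
open Polynomial

/-- The integer vectors `v` and `w` generate the lattice of relations
`n₀ x + n₁ y + n₂ z = 0`. -/
def SpansRelations (n₀ n₁ n₂ : ℤ) (v w : ℤ × ℤ × ℤ) : Prop :=
  n₀ * v.1 + n₁ * v.2.1 + n₂ * v.2.2 = 0 ∧ n₀ * w.1 + n₁ * w.2.1 + n₂ * w.2.2 = 0 ∧
    ∀ x y z : ℤ, n₀ * x + n₁ * y + n₂ * z = 0 → ∃ s t : ℤ,
      x = s * v.1 + t * w.1 ∧ y = s * v.2.1 + t * w.2.1 ∧ z = s * v.2.2 + t * w.2.2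

/-- A basis of the relation lattice given by two binomials `x ^ α - y ^ β * z ^ γ` and
`y ^ b - x ^ a * z ^ c` whose exponents satisfy `a ≤ α` and `β < b`. -/
def HasAdaptedBasis (n₀ n₁ n₂ : ℤ) : Prop :=
  ∃ α β γ a b c : ℕ, 0 < α ∧ a ≤ α ∧ β < b ∧ 0 < c ∧
    SpansRelations n₀ n₁ n₂ (α, -β, -γ) (-a, b, -c)

theorem SpansRelations.hasAdaptedBasis {n₀ n₁ n₂ α β γ a b c : ℤ}
    (h : SpansRelations n₀ n₁ n₂ (α, -β, -γ) (-a, b, -c)) (hα : 0 < α) (hβ : 0 ≤ β)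
    (hγ : 0 ≤ γ) (ha : 0 ≤ a) (haα : a ≤ α) (hβb : β < b) (hc : 0 < c) :
    HasAdaptedBasis n₀ n₁ n₂ := by
  have hb : 0 ≤ b := by lia
  lift α to ℕ using hα.le
  lift β to ℕ using hβ
  lift γ to ℕ using hγ
  lift a to ℕ using ha
  lift b to ℕ using hb
  lift c to ℕ using hc.le
  exact ⟨α, β, γ, a, b, c, by lia, by lia, by lia, by lia, h⟩

/-- Euclidean descent: a basis of two vectors of sign pattern `(-, +, -)` can be transformed into
an adapted basis. -/
theorem hasAdaptedBasis_of_descent {n₀ n₁ n₂ : ℤ} (h₀ : 0 < n₀) (h₂ : 0 < n₂)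
    (N : ℕ) : ∀ a b c α β δ : ℤ, b.toNat ≤ N → 0 ≤ a → a < α → 0 ≤ β → β < b → 0 < δ →
      SpansRelations n₀ n₁ n₂ (-a, b, -c) (-α, β, -δ) → HasAdaptedBasis n₀ n₁ n₂ := by
  induction N with
  | zero => intros; lia
  | succ N ih =>
    rintro a b c α β δ hN ha haα hβ hβb hδ ⟨hv, hw, hspan⟩
    simp only at hv hw hspan
    have hβ0 : 0 < β := by
      rcases hβ.lt_or_eq with h | h
      · exact h
      · subst h
        nlinarith [mul_pos h₀ (ha.trans_lt haα), mul_pos h₂ hδ]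
    -- `m` is the ceiling of `b / β`
    obtain ⟨m, hm₁, hm₂⟩ : ∃ m : ℤ, b ≤ m * β ∧ m * β < b + β := by
      refine ⟨-(-b / β), ?_, ?_⟩
      · have := Int.ediv_mul_le (-b) hβ0.ne'
        linarith
      · have := Int.lt_ediv_add_one_mul_self (-b) hβ0
        linarith
    have hm : 2 ≤ m := by
      by_contra hlt
      have : m ≤ 1 := by lia
      nlinarith
    have hmα : α ≤ m * α - a := by nlinarith
    by_cases hz : -c + m * δ ≤ 0
    · refine SpansRelations.hasAdaptedBasis (α := m * α - a) (β := m * β - b) (γ := c - m * δ)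
        (a := α) (b := β) (c := δ) ⟨?_, ?_, ?_⟩ (by lia) (by lia) (by lia) (by lia) hmα
        (by lia) hδ
      · simp only; linear_combination hv - m * hw
      · exact hw
      · intro x y z h
        obtain ⟨s, t, hx, hy, hz⟩ := hspan x y z h
        refine ⟨s, t + m * s, ?_, ?_, ?_⟩ <;> simp only
        · linear_combination hx
        · linear_combination hy
        · linear_combination hz
    · rcases hmα.lt_or_eq with hlt | heq
      · refine ih α β δ (m * α - a) (m * β - b) (-c + m * δ) (by lia) (by lia) hlt (by lia)
          (by lia) (by lia) ⟨hw, ?_, ?_⟩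
        · simp only; linear_combination m * hw - hv
        · intro x y z h
          obtain ⟨s, t, hx, hy, hz⟩ := hspan x y z h
          refine ⟨t + m * s, -s, ?_, ?_, ?_⟩ <;> simp only
          · linear_combination hx
          · linear_combination hy
          · linear_combination hz
      · nlinarith

theorem hasAdaptedBasis {n₀ n₁ n₂ : ℤ} (h₀ : 0 < n₀) (h₁ : 0 < n₁) (h₂ : 0 < n₂)
    (hgcd : ∀ d : ℤ, d ∣ n₀ → d ∣ n₁ → d ∣ n₂ → IsUnit d) : HasAdaptedBasis n₀ n₁ n₂ := by
  obtain ⟨g, n₁', n₂', hg, hcop, e₁, e₂⟩ : ∃ g m₁ m₂ : ℤ, 0 < g ∧ IsCoprime m₁ m₂ ∧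
      n₁ = g * m₁ ∧ n₂ = g * m₂ := by
    have hpos : 0 < Int.gcd n₁ n₂ := Int.gcd_pos_of_ne_zero_left _ h₁.ne'
    refine ⟨Int.gcd n₁ n₂, n₁ / Int.gcd n₁ n₂, n₂ / Int.gcd n₁ n₂, by exact_mod_cast hpos, ?_,
      (Int.mul_ediv_cancel' (Int.gcd_dvd_left ..)).symm,
      (Int.mul_ediv_cancel' (Int.gcd_dvd_right ..)).symm⟩
    rw [Int.isCoprime_iff_gcd_eq_one]
    exact Int.gcd_ediv_gcd_ediv_gcd hpos
  subst e₁ e₂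
  have h₁' : 0 < n₁' := pos_of_mul_pos_right h₁ hg.le
  have h₂' : 0 < n₂' := pos_of_mul_pos_right h₂ hg.le
  have hgn : IsCoprime g n₀ := by
    rw [← gcd_isUnit_iff]
    exact hgcd _ (gcd_dvd_right _ _) ((gcd_dvd_left _ _).mul_right _)
      ((gcd_dvd_left _ _).mul_right _)
  -- write `n₀ = β n₁' + γ n₂'` with `0 ≤ β < n₂'`
  obtain ⟨β, γ, hβ, hβ', hn₀⟩ : ∃ β γ : ℤ, 0 ≤ β ∧ β < n₂' ∧ n₀ = β * n₁' + γ * n₂' := by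
    obtain ⟨p, q, hpq⟩ := hcop
    refine ⟨(n₀ * p) % n₂', n₀ * q + (n₀ * p) / n₂' * n₁', Int.emod_nonneg _ h₂'.ne',
      Int.emod_lt_of_pos _ h₂', ?_⟩
    linear_combination (-n₀) * hpq - n₁' * Int.emod_add_mul_ediv (n₀ * p) n₂'
  have hspan : ∀ x y z : ℤ, n₀ * x + g * n₁' * y + g * n₂' * z = 0 → ∃ s t : ℤ,
      x = s * g ∧ y = s * -β + t * n₂' ∧ z = s * -γ + t * -n₁' := by
    intro x y z h
    obtain ⟨s, rfl⟩ : g ∣ x := hgn.dvd_of_dvd_mul_left ⟨-(n₁' * y + n₂' * z), by linarith⟩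
    have hyz : n₁' * (y + s * β) = -(n₂' * (z + s * γ)) := by
      apply mul_left_cancel₀ hg.ne'
      linear_combination h - g * s * hn₀
    obtain ⟨t, ht⟩ : n₂' ∣ y + s * β :=
      hcop.symm.dvd_of_dvd_mul_left ⟨-(z + s * γ), by linarith⟩
    refine ⟨s, t, by ring, by linarith, ?_⟩
    apply mul_left_cancel₀ h₂'.ne'
    rw [ht] at hyz
    linear_combination hyz
  by_cases hγ : 0 ≤ γ
  · refine SpansRelations.hasAdaptedBasis (α := g) (β := β) (γ := γ) (a := 0) (b := n₂')
      (c := n₁') ⟨?_, ?_, ?_⟩ hg hβ hγ le_rfl hg.le hβ' h₁'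
    · simp only; linear_combination g * hn₀
    · simp only; ring
    · intro x y z h
      obtain ⟨s, t, hx, hy, hz⟩ := hspan x y z h
      exact ⟨s, t, by simp [hx], hy, hz⟩
  · refine hasAdaptedBasis_of_descent h₀ h₂ _ 0 n₂' n₁' g β (-γ) le_rfl le_rfl hg hβ hβ'
      (by lia) ⟨?_, ?_, ?_⟩
    · simp only; ring
    · simp only; linear_combination (-g) * hn₀
    · intro x y z h
      obtain ⟨s, t, hx, hy, hz⟩ := hspan x y z h
      exact ⟨t, -s, by simp [hx], by simp only; linarith, by simp only; linarith⟩

theorem exponent_bound {α β a b i : ℕ} (haα : a ≤ α) (hβb : β < b) (hi : i ≤ α) :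
    β * a + (α - i) ≤ b * (α - i) + β * (a * i / α) := by
  obtain ⟨j, rfl⟩ := Nat.exists_eq_add_of_le hi
  rcases Nat.eq_zero_or_pos (i + j) with h | h
  · have : a = 0 := by lia
    simp [this]
    nlinarith
  have key : a ≤ j + a * i / (i + j) := by
    have : a ≤ j + (a * i / (i + j)) ↔ a - j ≤ a * i / (i + j) := by lia
    rw [this, Nat.le_div_iff_mul_le h]
    rcases le_total a j with haj | haj
    · simp [Nat.sub_eq_zero_of_le haj]
    · obtain ⟨e, rfl⟩ := Nat.exists_eq_add_of_le haj
      have : e ≤ i := by lia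
      simp only [Nat.add_sub_cancel_left]
      nlinarith
  rw [Nat.add_sub_cancel_left]
  nlinarith [Nat.mul_le_mul_left β key]

/-- The second equation: `(y ^ b - x ^ a * z ^ c) ^ α`, rewritten by means of
`x ^ α = y ^ β * z ^ γ` and divided by `y ^ (β * a)`. -/
def secondEquation {A : Type*} [CommRing A] (α β γ a b c : ℕ) (x y z : A) : A :=
  ∑ i ∈ Finset.range (α + 1), (-1) ^ i * (α.choose i : A) * x ^ (a * i % α) *
    y ^ (b * (α - i) + β * (a * i / α) - β * a) * z ^ (γ * (a * i / α) + c * i)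

theorem map_secondEquation {A B : Type*} [CommRing A] [CommRing B] (f : A →+* B)
    (α β γ a b c : ℕ) (x y z : A) :
    f (secondEquation α β γ a b c x y z) = secondEquation α β γ a b c (f x) (f y) (f z) := by
  simp [secondEquation]

section

variable {A : Type*} [CommRing A] {α β γ a b c : ℕ} {x y z : A}

theorem pow_mul_secondEquation (haα : a ≤ α) (hβb : β < b) (h : x ^ α = y ^ β * z ^ γ) :
    y ^ (β * a) * secondEquation α β γ a b c x y z = (y ^ b - x ^ a * z ^ c) ^ α := by
  rw [secondEquation, Finset.mul_sum, sub_eq_neg_add, add_pow]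
  refine Finset.sum_congr rfl fun i hi => ?_
  have hi' : i ≤ α := by simpa [Nat.lt_succ_iff] using hi
  obtain ⟨e, he⟩ := Nat.exists_eq_add_of_le
    ((Nat.le_add_right _ _).trans (exponent_bound haα hβb hi'))
  have hx : (x ^ a) ^ i = x ^ (a * i % α) * (y ^ β * z ^ γ) ^ (a * i / α) := by
    rw [← h, ← pow_mul, ← pow_mul, ← pow_add, Nat.mod_add_div]
  have hy : y ^ (β * a) * y ^ e = (y ^ b) ^ (α - i) * (y ^ β) ^ (a * i / α) := by
    rw [← pow_add, ← he, pow_add, pow_mul, pow_mul]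
  rw [he, Nat.add_sub_cancel_left, neg_pow (x ^ a * z ^ c), mul_pow, hx, mul_pow, pow_add, pow_mul z, pow_mul z]
  linear_combination (-1) ^ i * (α.choose i : A) * x ^ (a * i % α) * (z ^ γ) ^ (a * i / α) *
    (z ^ c) ^ i * hy

theorem secondEquation_of_y_eq_zero (hα : 0 < α) (haα : a ≤ α) (hβb : β < b) :
    secondEquation α β γ a b c x 0 z = (-1) ^ α * z ^ (γ * a + c * α) := by
  rw [secondEquation, Finset.sum_eq_single α]
  · simp [Nat.mul_div_cancel _ hα]
  · intro i hi hne
    have hlt : i < α := by have := Finset.mem_range.1 hi; lia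
    have := exponent_bound haα hβb hlt.le
    rw [zero_pow (by lia)]
    ring
  · simp

theorem secondEquation_of_z_eq_zero (hc : 0 < c) :
    secondEquation α β γ a b c x y 0 = y ^ (b * α - β * a) := by
  rw [secondEquation, Finset.sum_eq_single 0]
  · simp
  · intro i _ hne
    rw [zero_pow (Nat.add_pos_right _ (Nat.mul_pos hc (Nat.pos_of_ne_zero hne))).ne', mul_zero]
  · simp

theorem eq_zero_or_ne_zero_of_equations [IsDomain A] (hα : 0 < α) (haα : a ≤ α) (hβb : β < b)
    (hc : 0 < c) (hβγ : 0 < β + γ) (h₁ : x ^ α = y ^ β * z ^ γ)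
    (h₂ : secondEquation α β γ a b c x y z = 0) :
    (x = 0 ∧ y = 0 ∧ z = 0) ∨ (x ≠ 0 ∧ y ≠ 0 ∧ z ≠ 0) := by
  have hyz : y = 0 ↔ z = 0 := by
    constructor
    · rintro rfl
      rw [secondEquation_of_y_eq_zero hα haα hβb] at h₂
      exact eq_zero_of_pow_eq_zero ((mul_eq_zero.1 h₂).resolve_left (by simp))
    · rintro rfl
      rw [secondEquation_of_z_eq_zero hc] at h₂
      exact eq_zero_of_pow_eq_zero h₂
  have hxy : x = 0 ↔ y = 0 := by
    rw [← pow_eq_zero_iff hα.ne', h₁, mul_eq_zero, pow_eq_zero_iff', pow_eq_zero_iff', ← hyz]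
    have : β ≠ 0 ∨ γ ≠ 0 := by lia
    tauto
  tauto

end

section

variable {F : Type*} [Field F] {n₀ n₁ n₂ : ℕ}

/-- A point of the torus satisfying the two basic relations satisfies all of them. -/
theorem SpansRelations.zpow_eq_one {v w : ℤ × ℤ × ℤ} (h : SpansRelations n₀ n₁ n₂ v w) {x y z : F}
    (hx : x ≠ 0) (hy : y ≠ 0) (hz : z ≠ 0)
    (hv : x ^ v.1 * y ^ v.2.1 * z ^ v.2.2 = 1) (hw : x ^ w.1 * y ^ w.2.1 * z ^ w.2.2 = 1)
    {p q r : ℤ} (hpqr : n₀ * p + n₁ * q + n₂ * r = 0) : x ^ p * y ^ q * z ^ r = 1 := by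
  obtain ⟨s, t, rfl, rfl, rfl⟩ := h.2.2 p q r hpqr
  calc _ = (x ^ v.1 * y ^ v.2.1 * z ^ v.2.2) ^ s * (x ^ w.1 * y ^ w.2.1 * z ^ w.2.2) ^ t := by
        simp only [zpow_add₀ hx, zpow_add₀ hy, zpow_add₀ hz, mul_zpow, ← zpow_mul,
          mul_comm s, mul_comm t]
        ring
    _ = 1 := by simp [hv, hw]

theorem exists_parameter {p₀ p₁ p₂ : ℤ} (hp : n₀ * p₀ + n₁ * p₁ + n₂ * p₂ = 1) {x y z : F}
    (hx : x ≠ 0) (hy : y ≠ 0) (hz : z ≠ 0)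
    (h : ∀ p q r : ℤ, n₀ * p + n₁ * q + n₂ * r = 0 → x ^ p * y ^ q * z ^ r = 1) :
    ∃ t : F, x = t ^ n₀ ∧ y = t ^ n₁ ∧ z = t ^ n₂ := by
  have key : ∀ m : ℕ, (x ^ p₀ * y ^ p₁ * z ^ p₂) ^ m =
      x ^ (p₀ * m) * y ^ (p₁ * m) * z ^ (p₂ * m) := fun m => by
    simp only [mul_pow, zpow_mul, zpow_natCast]
  refine ⟨x ^ p₀ * y ^ p₁ * z ^ p₂, ?_, ?_, ?_⟩
  · have := h (p₀ * n₀ - 1) (p₁ * n₀) (p₂ * n₀) (by linear_combination (n₀ : ℤ) * hp)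
    rw [zpow_sub_one₀ hx] at this
    rw [key]
    field_simp at this
    exact this.symm
  · have := h (p₀ * n₁) (p₁ * n₁ - 1) (p₂ * n₁) (by linear_combination (n₁ : ℤ) * hp)
    rw [zpow_sub_one₀ hy] at this
    rw [key]
    field_simp at this
    exact this.symm
  · have := h (p₀ * n₂) (p₁ * n₂) (p₂ * n₂ - 1) (by linear_combination (n₂ : ℤ) * hp)
    rw [zpow_sub_one₀ hz] at this
    rw [key]
    field_simp at this
    exact this.symm

theorem exists_parameter_of_equations {α β γ a b c : ℕ} (h₀ : 0 < n₀) (h₁ : 0 < n₁) (h₂ : 0 < n₂)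
    {p₀ p₁ p₂ : ℤ} (hp : n₀ * p₀ + n₁ * p₁ + n₂ * p₂ = 1)
    (hα : 0 < α) (haα : a ≤ α) (hβb : β < b) (hc : 0 < c)
    (hspan : SpansRelations n₀ n₁ n₂ (α, -β, -γ) (-a, b, -c)) {x y z : F}
    (hf₁ : x ^ α = y ^ β * z ^ γ) (hf₂ : secondEquation α β γ a b c x y z = 0) :
    ∃ t : F, x = t ^ n₀ ∧ y = t ^ n₁ ∧ z = t ^ n₂ := by
  have hβγ : 0 < β + γ := by
    by_contra h0
    obtain ⟨rfl, rfl⟩ : β = 0 ∧ γ = 0 := by lia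
    have := hspan.1
    simp at this
    lia
  rcases eq_zero_or_ne_zero_of_equations hα haα hβb hc hβγ hf₁ hf₂ with
    ⟨rfl, rfl, rfl⟩ | ⟨hx, hy, hz⟩
  · exact ⟨0, by simp [h₀.ne'], by simp [h₁.ne'], by simp [h₂.ne']⟩
  · refine exists_parameter hp hx hy hz fun p q r => hspan.zpow_eq_one hx hy hz ?_ ?_
    · simp only [zpow_neg, zpow_natCast, hf₁]
      field_simp
    · have hpow := pow_mul_secondEquation (c := c) haα hβb hf₁
      rw [hf₂, mul_zero, eq_comm, pow_eq_zero_iff hα.ne', sub_eq_zero] at hpow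
      simp only [zpow_neg, zpow_natCast, hpow]
      field_simp

end

/-- **Bresinsky.** Let `k` be a field and `n₀, n₁, n₂` positive
integers with `gcd(n₀,n₁,n₂) = 1`.  Then the defining ideal
`𝔭(n₀,n₁,n₂) ⊆ k[x₀,x₁,x₂]` is a set-theoretic complete intersection: there exist
polynomials `f₁, f₂` with `𝔭(n₀,n₁,n₂) = √(f₁, f₂)`. -/
theorem bresinsky_stci_dim_three (k : Type*) [Field k] (n : Fin 3 → ℕ)
    (hpos : ∀ i, 0 < n i) (hgcd : ∀ d : ℕ, (∀ i, d ∣ n i) → d = 1) :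
    ∃ f₁ f₂ : MvPolynomial (Fin 3) k,
      RingHom.ker (MvPolynomial.aeval (R := k) fun i => (X : k[X]) ^ n i).toRingHom =
        (Ideal.span {f₁, f₂}).radical := by
  have hunit : ∀ d : ℤ, d ∣ n 0 → d ∣ n 1 → d ∣ n 2 → IsUnit d := fun d d₀ d₁ d₂ => by
    refine Int.isUnit_iff_natAbs_eq.2 (hgcd _ fun i => ?_)
    fin_cases i <;> exact Int.natCast_dvd_natCast.1 (by simpa)
  obtain ⟨α, β, γ, a, b, c, hα, haα, hβb, hc, hspan⟩ := hasAdaptedBasis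
    (by exact_mod_cast hpos 0) (by exact_mod_cast hpos 1) (by exact_mod_cast hpos 2) hunit
  obtain ⟨p₀, p₁, p₂, hp⟩ :
      ∃ p₀ p₁ p₂ : ℤ, (n 0 : ℤ) * p₀ + n 1 * p₁ + n 2 * p₂ = 1 := by
    have hcop : IsCoprime (gcd (n 0 : ℤ) (n 1)) (n 2) := by
      rw [← gcd_isUnit_iff]
      exact hunit _ ((gcd_dvd_left _ _).trans (gcd_dvd_left _ _))
        ((gcd_dvd_left _ _).trans (gcd_dvd_right _ _)) (gcd_dvd_right _ _)
    obtain ⟨u, v, huv⟩ := hcop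
    obtain ⟨s, t, hst⟩ := exists_gcd_eq_mul_add_mul (n 0 : ℤ) (n 1)
    exact ⟨u * s, u * t, v, by linear_combination huv - u * hst⟩
  let x : Fin 3 → MvPolynomial (Fin 3) k := MvPolynomial.X
  refine ⟨x 0 ^ α - x 1 ^ β * x 2 ^ γ, secondEquation α β γ a b c (x 0) (x 1) (x 2),
    le_antisymm ?_ ?_⟩
  · intro g hg
    rw [Ideal.radical_eq_sInf, Ideal.mem_sInf]
    rintro P ⟨hP, hprime⟩
    rw [Ideal.span_le, Set.pair_subset_iff] at hP
    let F := FractionRing (MvPolynomial (Fin 3) k ⧸ P)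
    let φ : MvPolynomial (Fin 3) k →ₐ[k] F :=
      (Algebra.algHom k (MvPolynomial (Fin 3) k ⧸ P) F).comp (Ideal.Quotient.mkₐ k P)
    have hφ : ∀ f, φ f = 0 ↔ f ∈ P := fun f => by
      rw [← Ideal.Quotient.eq_zero_iff_mem]
      exact IsFractionRing.to_map_eq_zero_iff 
        (R := MvPolynomial (Fin 3) k ⧸ P) (K := F)
    have hf₁ := (hφ _).2 hP.1
    have hf₂ := (hφ _).2 hP.2
    rw [map_sub, map_mul, map_pow, map_pow, map_pow, sub_eq_zero] at hf₁
    have hmap := map_secondEquation φ.toRingHom α β γ a b c (x 0) (x 1) (x 2)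
    obtain ⟨t, ht₀, ht₁, ht₂⟩ := exists_parameter_of_equations (hpos 0) (hpos 1) (hpos 2) hp
      hα haα hβb hc hspan hf₁ (hmap.symm.trans hf₂)
    have hcomp : φ = (aeval t).comp (MvPolynomial.aeval fun i => (X : k[X]) ^ n i) := by
      refine MvPolynomial.algHom_ext fun i => ?_
      fin_cases i <;> simpa
    have hg' : MvPolynomial.aeval (R := k) (fun i => (X : k[X]) ^ n i) g = 0 := hg
    rw [← hφ, hcomp, AlgHom.comp_apply, hg', map_zero]
  · rw [(RingHom.ker_isPrime _).radical_le_iff, Ideal.span_le, Set.pair_subset_iff]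
    have hdeg : n 0 * α = n 1 * β + n 2 * γ := by
      have := hspan.1
      simp only at this
      zify
      linarith
    have hdeg' : n 1 * b = n 0 * a + n 2 * c := by
      have := hspan.2.1
      simp only at this
      zify
      linarith
    have hrel : ((X : k[X]) ^ n 0) ^ α = (X ^ n 1) ^ β * (X ^ n 2) ^ γ := by
      rw [← pow_mul, ← pow_mul, ← pow_mul, ← pow_add, hdeg]
    have hrel' : ((X : k[X]) ^ n 1) ^ b = (X ^ n 0) ^ a * (X ^ n 2) ^ c := by
      rw [← pow_mul, ← pow_mul, ← pow_mul, ← pow_add, hdeg']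
    refine ⟨?_, ?_⟩
    · simp [x, RingHom.mem_ker, hrel]
    · have hmul := pow_mul_secondEquation (c := c) haα hβb hrel
      rw [hrel', sub_self, zero_pow hα.ne', mul_eq_zero] at hmul
      rw [SetLike.mem_coe, RingHom.mem_ker, map_secondEquation]
      simpa [x] using hmul.resolve_left (by simp)
end
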